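/- arXiv:1202.5774 — 5 statements merged into one kernel-verified Lean document; each statement's English description precedes it below -/
import Mathlib

section
/- Let η = (29 + 3√93)/2, the fundamental unit of ℚ(√93), regarded as an element of the number field K = ℚ(√−3, √93) ⊂ ℂ. Let p be a prime with p ≡ 1 (mod 3), p ≠ 31, such that −31 is a quadratic residue modulo p, and let P be any prime ideal of 𝓞_K lying above p. Then η is a cube in the residue field 𝓞_K/P if and only if there exist integers x, y with p = x² + xy + 8y². -/
open NumberField IntermediateField

/-- The biquadratic field `K = ℚ(√-3, √93) ⊂ ℂ`. -/
noncomputable def Ksqrt93 : IntermediateField ℚ ℂ :=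
  ℚ⟮(Complex.I * Real.sqrt 3 : ℂ), ((Real.sqrt 93 : ℝ) : ℂ)⟯

/-- The ring `ℤ[ω]` of Eisenstein integers, where `ω ^ 2 = -1 - ω`. -/
abbrev EisensteinInt : Type := QuadraticAlgebra ℤ (-1) (-1)

namespace EisensteinInt

open QuadraticAlgebra hiding norm

/-- The norm `a + b ω ↦ a ^ 2 - a b + b ^ 2` of `ℤ[ω]`. -/
abbrev N : EisensteinInt →* ℤ := QuadraticAlgebra.norm

/-- The primitive cube root of unity of `ℤ[ω]`. -/
def w : EisensteinInt := ⟨0, 1⟩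

theorem w_sq : w ^ 2 = -1 - w := by
  ext <;> simp [w, sq]

theorem w_cube : w ^ 3 = 1 := by
  ext <;> simp [w, pow_succ]

theorem star_w : star w = w ^ 2 := by
  ext <;> simp [w, sq]

theorem N_eq (z : EisensteinInt) : N z = z.re ^ 2 - z.re * z.im + z.im ^ 2 := by
  rw [norm_def]; ring

theorem intCast_dvd_iff {n : ℤ} {z : EisensteinInt} :
    (n : EisensteinInt) ∣ z ↔ n ∣ z.re ∧ n ∣ z.im := by
  constructor
  · rintro ⟨c, rfl⟩
    exact ⟨⟨c.re, by simp⟩, ⟨c.im, by simp⟩⟩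
  · rintro ⟨⟨a, ha⟩, ⟨b, hb⟩⟩
    exact ⟨⟨a, b⟩, by ext <;> simp [ha, hb]⟩

theorem N_nonneg (z : EisensteinInt) : 0 ≤ N z := by
  rw [N_eq]; nlinarith [sq_nonneg (z.re - z.im), sq_nonneg z.re, sq_nonneg z.im]

theorem N_eq_zero {z : EisensteinInt} : N z = 0 ↔ z = 0 := by
  constructor
  · intro h
    rw [N_eq] at h
    have h1 : z.im = 0 := by
      by_contra hne
      have := sq_pos_of_ne_zero hne
      nlinarith [sq_nonneg (2 * z.re - z.im)]
    have h2 : z.re = 0 := by simpa [h1] using h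
    ext <;> simp [h1, h2]
  · rintro rfl; simp

instance : IsDomain EisensteinInt :=
  have : NoZeroDivisors EisensteinInt := ⟨fun {a b} h ↦ by
    have := congrArg N h
    rw [map_mul, QuadraticAlgebra.norm_zero, mul_eq_zero] at this
    simpa [N_eq_zero] using this⟩
  NoZeroDivisors.to_isDomain _

/-- Division with rounding to a nearby Eisenstein integer. -/
theorem exists_N_sub_mul_lt (a : EisensteinInt) {b : EisensteinInt} (hb : b ≠ 0) :
    ∃ q : EisensteinInt, N (a - b * q) < N b := by
  set c := a * star b with hc
  have hN : 0 < N b := lt_of_le_of_ne (N_nonneg b) fun h ↦ hb (N_eq_zero.1 h.symm)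
  have key : ∀ m : ℤ, ∃ t : ℤ, 2 * |m - N b * t| ≤ N b := by
    intro m
    refine ⟨(2 * m + N b) / (2 * N b), ?_⟩
    have h1 := Int.emod_add_mul_ediv (2 * m + N b) (2 * N b)
    have h2 := Int.emod_nonneg (2 * m + N b) (by positivity : 2 * N b ≠ 0)
    have h3 := Int.emod_lt_of_pos (2 * m + N b) (by positivity : 0 < 2 * N b)
    rw [← abs_two, ← abs_mul, abs_le]
    constructor <;> simp only [abs_two] <;> nlinarith
  obtain ⟨t, ht⟩ := key c.re
  obtain ⟨u, hu⟩ := key c.im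
  refine ⟨⟨t, u⟩, ?_⟩
  have hstar : b * star b = (N b : EisensteinInt) := by
    rw [← algebraMap_norm_eq_mul_star]; rfl
  have h4 : (a - b * ⟨t, u⟩) * star b = c - N b * ⟨t, u⟩ := by
    rw [← hstar, hc]; ring
  have h5 := congrArg N h4
  rw [map_mul, QuadraticAlgebra.norm_star, N_eq (c - _)] at h5
  simp only [re_sub, re_mul, re_intCast, im_intCast, im_sub, im_mul, Int.cast_id] at h5
  set x := c.re - N b * t with hx
  set y := c.im - N b * u with hy
  have h6 : N (a - b * ⟨t, u⟩) * N b = x ^ 2 - x * y + y ^ 2 := by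
    rw [h5, hx, hy]; ring
  have hx2 : |x| * |x| = x ^ 2 := by rw [abs_mul_abs_self]; ring
  have hy2 : |y| * |y| = y ^ 2 := by rw [abs_mul_abs_self]; ring
  have hxy : -(x * y) ≤ |x| * |y| := by rw [← abs_mul]; exact neg_le_abs _
  have : N (a - b * ⟨t, u⟩) * N b < N b * N b := by
    nlinarith [abs_nonneg x, abs_nonneg y, mul_pos hN hN]
  exact lt_of_mul_lt_mul_right this hN.le

noncomputable instance : EuclideanDomain EisensteinInt where
  quotient a b := open Classical in
    if hb : b = 0 then 0 else (exists_N_sub_mul_lt a hb).choose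
  remainder a b := open Classical in
    if hb : b = 0 then a else a - b * (exists_N_sub_mul_lt a hb).choose
  quotient_zero a := by simp
  quotient_mul_add_remainder_eq a b := by
    by_cases hb : b = 0 <;> simp [hb]
  r a b := (N a).natAbs < (N b).natAbs
  r_wellFounded := (measure fun a : EisensteinInt ↦ (N a).natAbs).wf
  remainder_lt a b hb := by
    simp only [hb, dite_false]
    have := (exists_N_sub_mul_lt a hb).choose_spec
    have := N_nonneg (a - b * (exists_N_sub_mul_lt a hb).choose)
    omega
  mul_left_not_lt a b hb := by
    have h1 : 0 < (N b).natAbs := Int.natAbs_pos.2 fun h ↦ hb (N_eq_zero.1 h)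
    rw [map_mul, Int.natAbs_mul, not_lt]
    exact Nat.le_mul_of_pos_right _ h1

theorem mul_star_eq_N (z : EisensteinInt) : z * star z = (N z : EisensteinInt) := by
  rw [← algebraMap_norm_eq_mul_star]; rfl

theorem natCard_quotient (z : EisensteinInt) :
    Nat.card (EisensteinInt ⧸ Ideal.span {z}) = (N z).natAbs := by
  have h := Ideal.absNorm_span_singleton z
  have h2 : Algebra.norm ℤ z = N z := by
    rw [← det_toLinearMap_eq_norm]
    rfl
  rw [h2] at h
  rw [← h, Ideal.absNorm_apply]
  rfl

theorem isUnit_iff_N {z : EisensteinInt} : IsUnit z ↔ N z = 1 := by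
  rw [isUnit_iff_norm_isUnit, Int.isUnit_iff]
  have := N_nonneg z
  exact ⟨fun h ↦ h.resolve_right fun h ↦ by linarith, Or.inl⟩

/-- An Eisenstein integer is primary if it is congruent to `1` or `-1` modulo `3`. -/
def IsPrimary (z : EisensteinInt) : Prop := 3 ∣ z.im ∧ ¬ 3 ∣ z.re

/-- Associated primary elements agree up to sign. -/
theorem IsPrimary.eq_or_eq_neg {a b : EisensteinInt} (ha : IsPrimary a) (hb : IsPrimary b)
    (h : Associated a b) : b = a ∨ b = -a := by
  obtain ⟨u, rfl⟩ := h
  have hu := isUnit_iff_N.1 u.isUnit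
  rw [N_eq] at hu
  generalize (u : EisensteinInt) = v at *
  obtain ⟨⟨k, hk⟩, h2⟩ := ha
  obtain ⟨h3, h4⟩ := hb
  have h5 : 3 ∣ a.re * v.im := by
    have : a.re * v.im = (a * v).im - 3 * (k * v.re - k * v.im) := by
      simp [hk]; ring
    rw [this]
    exact dvd_sub h3 (dvd_mul_right _ _)
  have h6 : (3 : ℤ) ∣ v.im := (Int.prime_three.dvd_or_dvd h5).resolve_left h2
  obtain ⟨c, hc⟩ := h6
  have hc0 : c = 0 := by
    by_contra hne
    have := sq_pos_of_ne_zero hne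
    nlinarith [sq_nonneg (2 * v.re - v.im), congrArg (· ^ 2) hc]
  have him : v.im = 0 := by simp [hc, hc0]
  have hre : (v.re - 1) * (v.re + 1) = 0 := by
    rw [him] at hu; linarith
  rcases mul_eq_zero.1 hre with h | h
  · left
    have : v = 1 := by ext <;> simp [him]; linarith
    rw [this, mul_one]
  · right
    have : v = -1 := by ext <;> simp [him]; linarith
    rw [this, mul_neg_one]

theorem cube_eq_one_iff {z : EisensteinInt} : z ^ 3 = 1 ↔ z = 1 ∨ z = w ∨ z = w ^ 2 := by
  constructor
  · intro h
    have h1 : (z - 1) * ((z - w) * (z - w ^ 2)) = 0 := by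
      linear_combination h - (z - 1) * z * w_sq + (z - 1) * w_cube
    simpa [sub_eq_zero] using h1
  · rintro (rfl | rfl | rfl)
    · exact one_pow 3
    · exact w_cube
    · rw [← pow_mul, mul_comm, pow_mul, w_cube, one_pow]

theorem star_mul_self_of_cube_eq_one {z : EisensteinInt} (h : z ^ 3 = 1) : star z * z = 1 := by
  rcases cube_eq_one_iff.1 h with rfl | rfl | rfl
  · simp
  · rw [star_w, ← pow_succ, w_cube]
  · rw [star_pow, star_w, ← pow_mul, ← pow_add, show 2 * 2 + 2 = 3 * 2 from rfl, pow_mul, w_cube,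
      one_pow]

section CubicVal

variable {F : Type*} [CommRing F]

open Classical in
/-- The cube root of unity in `ℤ[ω]` which reduces to `x ^ ((#F - 1) / 3)` under `φ`. -/
noncomputable def cubicVal (φ : EisensteinInt →+* F) (x : F) : EisensteinInt :=
  if x = 0 then 0
  else if x ^ ((Nat.card F - 1) / 3) = 1 then 1
  else if x ^ ((Nat.card F - 1) / 3) = φ w then w
  else w ^ 2

theorem cubicVal_zero (φ : EisensteinInt →+* F) : cubicVal φ 0 = 0 := by simp [cubicVal]

theorem cubicVal_cube (φ : EisensteinInt →+* F) {x : F} (hx : x ≠ 0) : cubicVal φ x ^ 3 = 1 := by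
  rw [cube_eq_one_iff, cubicVal, if_neg hx]
  split_ifs <;> simp

end CubicVal

section CubicChar

variable {F : Type*} [Field F] (φ : EisensteinInt →+* F)

theorem map_w_ne_one (h3 : (3 : F) ≠ 0) : φ w ≠ 1 := fun h ↦ by
  have := congrArg φ w_sq
  simp only [map_pow, map_sub, map_neg, map_one, h] at this
  exact h3 (by linear_combination this)

theorem isPrimitiveRoot_map_w (h3 : (3 : F) ≠ 0) : IsPrimitiveRoot (φ w) 3 :=
  IsPrimitiveRoot.iff_orderOf.2 <| orderOf_eq_prime (by rw [← map_pow, w_cube, map_one])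
    (map_w_ne_one φ h3)

theorem eq_of_cube_eq_one_of_map_eq (h3 : (3 : F) ≠ 0) {y z : EisensteinInt} (hy : y ^ 3 = 1)
    (hz : z ^ 3 = 1) (h : φ y = φ z) : y = z := by
  have h1 := isPrimitiveRoot_map_w φ h3
  have h2 : ∀ i < 3, ∀ j < 3, φ (w ^ i) = φ (w ^ j) → w ^ i = w ^ j := fun i hi j hj hij ↦ by
    rw [h1.pow_inj hi hj (by simpa using hij)]
  rw [cube_eq_one_iff] at hy hz
  have hy' : ∃ i < 3, y = w ^ i := by
    rcases hy with rfl | rfl | rfl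
    exacts [⟨0, by simp⟩, ⟨1, by simp⟩, ⟨2, by simp⟩]
  have hz' : ∃ i < 3, z = w ^ i := by
    rcases hz with rfl | rfl | rfl
    exacts [⟨0, by simp⟩, ⟨1, by simp⟩, ⟨2, by simp⟩]
  obtain ⟨i, hi, rfl⟩ := hy'
  obtain ⟨j, hj, rfl⟩ := hz'
  exact h2 i hi j hj h

variable [Finite F]

theorem three_dvd_natCard_sub_one (φ : EisensteinInt →+* F) (h3 : (3 : F) ≠ 0) :
    3 ∣ Nat.card F - 1 := by
  have := Fintype.ofFinite F
  rw [(isPrimitiveRoot_map_w φ h3).eq_orderOf, Nat.card_eq_fintype_card]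
  apply orderOf_dvd_of_pow_eq_one
  exact FiniteField.pow_card_sub_one_eq_one _ ((isPrimitiveRoot_map_w φ h3).ne_zero (by simp))

theorem pow_third_ne_zero (φ : EisensteinInt →+* F) (h3 : (3 : F) ≠ 0) :
    (Nat.card F - 1) / 3 ≠ 0 := by
  have h1 := three_dvd_natCard_sub_one φ h3
  have h2 : 1 < Nat.card F := Finite.one_lt_card
  omega

theorem map_cubicVal (h3 : (3 : F) ≠ 0) (x : F) :
    φ (cubicVal φ x) = x ^ ((Nat.card F - 1) / 3) := by
  have := Fintype.ofFinite F
  rw [cubicVal]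
  split_ifs with h h1 h2
  · rw [h, map_zero, zero_pow (pow_third_ne_zero φ h3)]
  · rw [h1, map_one]
  · exact h2.symm
  · set y := x ^ ((Nat.card F - 1) / 3) with hy
    have hy3 : y ^ 3 = 1 := by
      rw [hy, ← pow_mul, Nat.div_mul_cancel (three_dvd_natCard_sub_one φ h3),
        Nat.card_eq_fintype_card, FiniteField.pow_card_sub_one_eq_one x h]
    have h4 : (y - 1) * ((y - φ w) * (y - φ w ^ 2)) = 0 := by
      have h5 := congrArg φ w_sq
      have h6 := congrArg φ w_cube
      simp only [map_pow, map_sub, map_neg, map_one] at h5 h6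
      linear_combination hy3 - (y - 1) * y * h5 + (y - 1) * h6
    simp only [mul_eq_zero, sub_eq_zero, h1, h2, false_or] at h4
    rw [map_pow, h4]

theorem cubicVal_mul (h3 : (3 : F) ≠ 0) (x y : F) :
    cubicVal φ (x * y) = cubicVal φ x * cubicVal φ y := by
  rcases eq_or_ne x 0 with rfl | hx
  · simp [cubicVal_zero]
  rcases eq_or_ne y 0 with rfl | hy
  · simp [cubicVal_zero]
  refine eq_of_cube_eq_one_of_map_eq φ h3 (cubicVal_cube φ (mul_ne_zero hx hy)) ?_ ?_
  · rw [mul_pow, cubicVal_cube φ hx, cubicVal_cube φ hy, one_mul]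
  · rw [map_mul, map_cubicVal φ h3, map_cubicVal φ h3, map_cubicVal φ h3, mul_pow]

/-- The cubic residue character of a finite field under `ℤ[ω]`. -/
noncomputable def cubicChar (h3 : (3 : F) ≠ 0) : MulChar F EisensteinInt where
  toFun := cubicVal φ
  map_one' := by
    have h : (1 : F) ≠ 0 := one_ne_zero
    simp [cubicVal]
  map_mul' := cubicVal_mul φ h3
  map_nonunit' a ha := by rw [isUnit_iff_ne_zero, not_not] at ha; rw [ha, cubicVal_zero]

theorem cubicChar_apply (h3 : (3 : F) ≠ 0) (x : F) : cubicChar φ h3 x = cubicVal φ x := rfl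

theorem cubicChar_pow_three (h3 : (3 : F) ≠ 0) : cubicChar φ h3 ^ 3 = 1 := by
  refine MulChar.ext fun x ↦ ?_
  rw [MulChar.pow_apply_coe, cubicChar_apply, cubicVal_cube φ x.ne_zero, MulChar.one_apply_coe]

theorem exists_cubicVal_ne_one (h3 : (3 : F) ≠ 0) : ∃ x : F, x ≠ 0 ∧ cubicVal φ x ≠ 1 := by
  have := Fintype.ofFinite F
  obtain ⟨g, hg⟩ := IsCyclic.exists_generator (α := Fˣ)
  refine ⟨g, g.ne_zero, fun h ↦ ?_⟩
  have h1 := map_cubicVal φ h3 (g : F)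
  rw [h, map_one, ← Units.val_pow_eq_pow_val, eq_comm, Units.val_eq_one] at h1
  have h2 := orderOf_dvd_of_pow_eq_one h1
  rw [orderOf_eq_card_of_forall_mem_zpowers hg, Nat.card_units] at h2
  have h4 := Nat.le_of_dvd (Nat.pos_of_ne_zero (pow_third_ne_zero φ h3)) h2
  have h5 := pow_third_ne_zero φ h3
  omega

theorem ringHomComp_cubicChar_ne_one (h3 : (3 : F) ≠ 0) {k : Type*} [Field k]
    (μ : EisensteinInt →+* k) (h3' : (3 : k) ≠ 0) : (cubicChar φ h3).ringHomComp μ ≠ 1 := by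
  obtain ⟨x, hx, hx1⟩ := exists_cubicVal_ne_one φ h3
  intro h
  have := congrArg (fun χ ↦ χ x) h
  simp only [MulChar.ringHomComp_apply, cubicChar_apply,
    MulChar.one_apply (isUnit_iff_ne_zero.2 hx)] at this
  exact hx1 (eq_of_cube_eq_one_of_map_eq μ h3' (cubicVal_cube φ hx) (one_pow 3)
    (by rw [this, map_one]))

theorem orderOf_ringHomComp_cubicChar (h3 : (3 : F) ≠ 0) {k : Type*} [Field k]
    (μ : EisensteinInt →+* k) (h3' : (3 : k) ≠ 0) :
    orderOf ((cubicChar φ h3).ringHomComp μ) = 3 :=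
  orderOf_eq_prime (by rw [MulChar.ringHomComp_pow, cubicChar_pow_three, MulChar.ringHomComp_one])
    (ringHomComp_cubicChar_ne_one φ h3 μ h3')

theorem cubicVal_neg_one (h3 : (3 : F) ≠ 0) : cubicVal φ (-1) = 1 := by
  have h : cubicChar φ h3 (-1) = cubicChar φ h3 (-1) ^ 3 := by
    rw [← map_pow]; norm_num
  rw [cubicChar_apply] at h
  rw [h, cubicVal_cube φ (neg_ne_zero.2 one_ne_zero)]

end CubicChar

section JacobiSum

variable {F : Type*} [Field F] [Fintype F] (φ : EisensteinInt →+* F) (h3 : (3 : F) ≠ 0)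

/-- The Jacobi sum `J(χ, χ)` of the cubic residue character. -/
noncomputable def cubicJacobiSum : EisensteinInt :=
  jacobiSum (cubicChar φ h3) (cubicChar φ h3)

theorem map_cubicJacobiSum : φ (cubicJacobiSum φ h3) = 0 := by
  set m := (Nat.card F - 1) / 3 with hm
  have h0 := pow_third_ne_zero φ h3
  have hlt : m + m < Fintype.card F - 1 := by
    rw [Nat.card_eq_fintype_card] at h0 hm
    omega
  have h1 : φ (cubicJacobiSum φ h3) = ∑ x : F, x ^ m * (1 - x) ^ m := by
    simp only [cubicJacobiSum, jacobiSum, map_sum, map_mul, cubicChar_apply, map_cubicVal φ h3,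
      hm]
  rw [h1]
  have h2 : ∀ x : F, x ^ m * (1 - x) ^ m
      = ∑ i ∈ Finset.range (m + 1), ((-1) ^ i * (m.choose i : F)) * x ^ (m + i) := by
    intro x
    rw [sub_eq_neg_add, add_pow, Finset.mul_sum]
    refine Finset.sum_congr rfl fun i _ ↦ ?_
    rw [neg_pow, one_pow, pow_add]; ring
  simp only [h2]
  rw [Finset.sum_comm]
  refine Finset.sum_eq_zero fun i hi ↦ ?_
  rw [← Finset.mul_sum, FiniteField.sum_pow_lt_card_sub_one, mul_zero]
  have := Finset.mem_range.1 hi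
  omega

theorem N_cubicJacobiSum : N (cubicJacobiSum φ h3) = Fintype.card F := by
  let μ : EisensteinInt →+* FractionRing EisensteinInt := algebraMap _ _
  have hμ : Function.Injective μ := IsFractionRing.injective _ _
  have : CharZero EisensteinInt := ⟨fun a b h ↦ by
    simpa using congrArg QuadraticAlgebra.re h⟩
  have : CharZero (FractionRing EisensteinInt) := charZero_of_injective_ringHom hμ
  have h3' : (3 : FractionRing EisensteinInt) ≠ 0 := by norm_num
  have hne := ringHomComp_cubicChar_ne_one φ h3 μ h3'
  have hord := orderOf_ringHomComp_cubicChar φ h3 μ h3'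
  have hch : ringChar (FractionRing EisensteinInt) ≠ ringChar F := by
    rw [ringChar.eq_zero]
    exact (CharP.ringChar_ne_zero_of_finite F).symm
  have h1 := jacobiSum_mul_jacobiSum_inv hch hne hne
    (by rw [← sq]; exact pow_ne_one_of_lt_orderOf two_ne_zero (by omega))
  have hstar : (cubicChar φ h3).ringHomComp (starRingEnd EisensteinInt) = (cubicChar φ h3)⁻¹ := by
    rw [eq_inv_iff_mul_eq_one]
    refine MulChar.ext fun x ↦ ?_
    rw [MulChar.mul_apply, MulChar.ringHomComp_apply, starRingEnd_apply, cubicChar_apply,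
      star_mul_self_of_cube_eq_one (cubicVal_cube φ x.ne_zero), MulChar.one_apply_coe]
  rw [MulChar.ringHomComp_inv, ← hstar, jacobiSum_ringHomComp, jacobiSum_ringHomComp,
    jacobiSum_ringHomComp, ← map_mul, starRingEnd_apply] at h1
  have h2 : cubicJacobiSum φ h3 * star (cubicJacobiSum φ h3) = (Fintype.card F : EisensteinInt) :=
    hμ (by rw [map_natCast]; exact h1)
  rw [mul_star_eq_N] at h2
  simpa using congrArg QuadraticAlgebra.re h2

theorem isPrimary_cubicJacobiSum : IsPrimary (cubicJacobiSum φ h3) := by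
  have hw : IsPrimitiveRoot w 3 := IsPrimitiveRoot.iff_orderOf.2 <|
    orderOf_eq_prime w_cube fun h ↦ by simpa [w] using congrArg QuadraticAlgebra.im h
  obtain ⟨z, -, hz⟩ := exists_jacobiSum_eq_neg_one_add (by norm_num) (cubicChar_pow_three φ h3)
    (cubicChar_pow_three φ h3)
    (by rw [← Nat.card_eq_fintype_card]; exact three_dvd_natCard_sub_one φ h3) hw
  have h2 : (w - 1) ^ 2 = -(3 : ℤ) * w := by push_cast; linear_combination w_sq
  have h3 : cubicJacobiSum φ h3 = -1 + (3 : ℤ) * (-z * w) := by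
    rw [cubicJacobiSum, hz, h2]; ring
  rw [IsPrimary, h3]
  simp only [re_add, re_neg, re_one, im_add, im_neg, im_one, re_mul, re_intCast, im_intCast, im_mul,
    Int.cast_id]
  constructor <;> omega

end JacobiSum

end EisensteinInt

theorem gaussSum_frob_pow {R R' : Type*} [CommRing R] [Fintype R] [CommRing R'] (χ : MulChar R R')
    (ψ : AddChar R R') (p : ℕ) [Fact p.Prime] [CharP R' p] (n : ℕ) :
    gaussSum χ ψ ^ p ^ n = gaussSum (χ ^ p ^ n) (ψ ^ p ^ n) := by
  induction n with
  | zero => simp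
  | succ n ih => rw [pow_succ, pow_mul, ih, gaussSum_frob, ← pow_mul, ← pow_mul]

namespace EisensteinInt

open QuadraticAlgebra hiding norm

section FieldReciprocity

variable {F k : Type*} [Field F] [Fintype F] [Field k] [Fintype k]
  (φ : EisensteinInt →+* F) (l : EisensteinInt →+* k)

/-- Cubic reciprocity for two residue fields of `ℤ[ω]` of different characteristic. -/
theorem cubicVal_mul_cubicVal_eq_one (h3 : (3 : F) ≠ 0) (h3' : (3 : k) ≠ 0)
    (hne : (Fintype.card F : k) ≠ 0) :
    cubicVal φ (Fintype.card k : F) *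
      cubicVal l (l (Fintype.card F * cubicJacobiSum φ h3)) = 1 := by
  have hch : ringChar k ≠ ringChar F := by
    intro h
    obtain ⟨n, -, hn⟩ := FiniteField.card F (ringChar F)
    apply hne
    rw [hn, ← h, Nat.cast_pow, ringChar.Nat.cast_ringChar, zero_pow n.ne_zero]
  let ψ := AddChar.FiniteField.primitiveChar F k hch
  let K := CyclotomicField ψ.n k
  let μ : EisensteinInt →+* K := (algebraMap k K).comp l
  have h3K : (3 : K) ≠ 0 := by
    rw [← map_ofNat (algebraMap k K) 3]
    exact (map_ne_zero _).2 h3'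
  set χ := (cubicChar φ h3).ringHomComp μ with hχ
  have hχ1 : χ ≠ 1 := ringHomComp_cubicChar_ne_one φ h3 μ h3K
  have hord : orderOf χ = 3 := orderOf_ringHomComp_cubicChar φ h3 μ h3K
  have hneK : (Fintype.card F : K) ≠ 0 := by
    rw [← map_natCast (algebraMap k K)]
    exact (map_ne_zero _).2 hne
  set g := gaussSum χ ψ.char with hg
  have hg0 : g ≠ 0 := gaussSum_ne_zero_of_nontrivial hneK hχ1 ψ.prim
  have hdvd : 3 ∣ Fintype.card k - 1 := by
    rw [← Nat.card_eq_fintype_card]; exact three_dvd_natCard_sub_one l h3'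
  set m := (Fintype.card k - 1) / 3 with hm
  have hcard : Fintype.card k = 3 * m + 1 := by
    have := Fintype.card_pos (α := k)
    omega
  have hg3 : g ^ 3 = μ (Fintype.card F * cubicJacobiSum φ h3) := by
    have h := gaussSum_pow_eq_prod_jacobiSum (χ := χ) (ψ := ψ.char) (by omega) ψ.prim
    rw [hord] at h
    rw [hg, h]
    simp only [Nat.reduceSub, Nat.Ico_succ_singleton, Finset.prod_singleton, pow_one]
    rw [hχ, jacobiSum_ringHomComp, MulChar.ringHomComp_apply, cubicChar_apply,
      cubicVal_neg_one φ h3, map_mul, map_one, one_mul, map_natCast]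
    rfl
  have hkF : (Fintype.card k : F) ≠ 0 := by
    obtain ⟨n, hp, hn⟩ := FiniteField.card k (ringChar k)
    rw [hn, Nat.cast_pow]
    apply pow_ne_zero
    intro h
    have h2 := (ringChar.spec F _).1 h
    exact hch ((Nat.prime_dvd_prime_iff_eq (CharP.char_is_prime F (ringChar F)) hp).1 h2).symm
  have hfrob : χ (Fintype.card k : F) * g ^ Fintype.card k = g := by
    obtain ⟨n, hp, hn⟩ := FiniteField.card k (ringChar k)
    have : Fact (ringChar k).Prime := ⟨hp⟩
    have : CharP K (ringChar k) := charP_of_injective_algebraMap (algebraMap k K).injective _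
    have h1 : g ^ Fintype.card k = gaussSum χ (AddChar.mulShift ψ.char (Fintype.card k : F)) := by
      rw [hg, hn, gaussSum_frob_pow, AddChar.pow_mulShift]
      congr 1
      rw [← hn, hcard, pow_succ, pow_mul, ← hord, pow_orderOf_eq_one, one_pow, one_mul]
    rw [h1]
    exact gaussSum_mulShift χ ψ.char (Units.mk0 _ hkF)
  have hfin : χ (Fintype.card k : F) * μ (Fintype.card F * cubicJacobiSum φ h3) ^ m = 1 := by
    rw [← hg3, ← pow_mul]
    apply mul_right_cancel₀ hg0
    rw [mul_assoc, ← pow_succ, ← hcard, hfrob, one_mul]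
  have hfin' : l (cubicVal φ (Fintype.card k : F)) *
      l (Fintype.card F * cubicJacobiSum φ h3) ^ m = 1 := by
    apply (algebraMap k K).injective
    rw [map_mul, map_pow, map_one]
    exact hfin
  have hx0 : l (Fintype.card F * cubicJacobiSum φ h3) ≠ 0 := by
    intro h
    rw [h, zero_pow, mul_zero] at hfin'
    · exact zero_ne_one hfin'
    · have := pow_third_ne_zero l h3'
      rwa [Nat.card_eq_fintype_card] at this
  refine eq_of_cube_eq_one_of_map_eq l h3' ?_ (one_pow 3) ?_
  · rw [mul_pow, cubicVal_cube φ hkF, cubicVal_cube l hx0, one_mul]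
  · rw [map_mul, map_cubicVal l h3', Nat.card_eq_fintype_card, hfin', map_one]

end FieldReciprocity

section PrimeSymbol

/-- The cubic residue symbol of `a` modulo an ideal (meaningful for prime ideals not over `3`). -/
noncomputable def idealSymbol (I : Ideal EisensteinInt) (a : EisensteinInt) : EisensteinInt :=
  cubicVal (Ideal.Quotient.mk I) (Ideal.Quotient.mk I a)

theorem idealSymbol_congr (I : Ideal EisensteinInt) {a b : EisensteinInt} (h : a - b ∈ I) :
    idealSymbol I a = idealSymbol I b := by
  rw [idealSymbol, idealSymbol, Ideal.Quotient.eq.2 h]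

theorem idealSymbol_cube {I : Ideal EisensteinInt} {a : EisensteinInt} (h : a ∉ I) :
    idealSymbol I a ^ 3 = 1 :=
  cubicVal_cube _ (by rwa [Ne, Ideal.Quotient.eq_zero_iff_mem])

theorem three_ne_zero_quotient {I : Ideal EisensteinInt} (h3 : 3 ∉ I) :
    (3 : EisensteinInt ⧸ I) ≠ 0 := by
  rw [← map_ofNat (Ideal.Quotient.mk I) 3, Ne, Ideal.Quotient.eq_zero_iff_mem]
  exact h3

theorem finite_quotient {z : EisensteinInt} (hz : z ≠ 0) :
    Finite (EisensteinInt ⧸ Ideal.span {z}) := by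
  apply Nat.finite_of_card_ne_zero
  rw [natCard_quotient]
  exact Int.natAbs_ne_zero.2 fun h ↦ hz (N_eq_zero.1 h)

variable {I : Ideal EisensteinInt} [hI : I.IsMaximal]

theorem idealSymbol_mul [Finite (EisensteinInt ⧸ I)] (h3 : 3 ∉ I) (a b : EisensteinInt) :
    idealSymbol I (a * b) = idealSymbol I a * idealSymbol I b := by
  let _ := Ideal.Quotient.field I
  rw [idealSymbol, map_mul]
  exact cubicVal_mul (Ideal.Quotient.mk I) (three_ne_zero_quotient h3) _ _

theorem idealSymbol_one [Finite (EisensteinInt ⧸ I)] (h3 : 3 ∉ I) : idealSymbol I 1 = 1 := by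
  let _ := Ideal.Quotient.field I
  rw [idealSymbol, map_one]
  exact map_one (cubicChar (Ideal.Quotient.mk I) (three_ne_zero_quotient h3))

theorem pow_sub_idealSymbol_mem [Finite (EisensteinInt ⧸ I)] (h3 : 3 ∉ I) (a : EisensteinInt) :
    a ^ ((Nat.card (EisensteinInt ⧸ I) - 1) / 3) - idealSymbol I a ∈ I := by
  let _ := Ideal.Quotient.field I
  rw [← Ideal.Quotient.eq, idealSymbol, map_pow]
  exact (map_cubicVal (Ideal.Quotient.mk I) (three_ne_zero_quotient h3) _).symm

/-- A cube root of unity which is congruent to `a ^ ((#(ℤ[ω]/I) - 1) / 3)` is the symbol of `a`. -/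
theorem eq_idealSymbol [Finite (EisensteinInt ⧸ I)] (h3 : 3 ∉ I) {a z : EisensteinInt} (ha : a ∉ I)
    (hz : z ^ 3 = 1) (h : a ^ ((Nat.card (EisensteinInt ⧸ I) - 1) / 3) - z ∈ I) :
    z = idealSymbol I a := by
  let _ := Ideal.Quotient.field I
  refine eq_of_cube_eq_one_of_map_eq (Ideal.Quotient.mk I) (three_ne_zero_quotient h3) hz
    (idealSymbol_cube ha) ?_
  rw [← Ideal.Quotient.eq.2 h, Ideal.Quotient.eq.2 (pow_sub_idealSymbol_mem h3 a)]

theorem isMaximal_of_prime {π : EisensteinInt} (hπ : Prime π) : (Ideal.span {π}).IsMaximal :=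
  PrincipalIdealRing.isMaximal_of_irreducible hπ.irreducible

/-- Every prime of `ℤ[ω]` not over `3` has a primary generator satisfying a reciprocity law with
respect to every other prime. -/
theorem exists_primary_associated {π : EisensteinInt} (hπ : Prime π) (h3 : ¬ π ∣ 3) :
    ∃ J, IsPrimary J ∧ Associated π J ∧ ∀ ρ, Prime ρ → ¬ ρ ∣ 3 → ¬ ρ ∣ (N π : EisensteinInt) →
      idealSymbol (Ideal.span {π}) (N ρ : EisensteinInt) *
        idealSymbol (Ideal.span {ρ}) (N π * J) = 1 := by
  have hm := isMaximal_of_prime hπ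
  have hfin := finite_quotient hπ.ne_zero
  let _ := Ideal.Quotient.field (Ideal.span {π})
  have := Fintype.ofFinite (EisensteinInt ⧸ Ideal.span {π})
  have h3' : (3 : EisensteinInt ⧸ Ideal.span {π}) ≠ 0 :=
    three_ne_zero_quotient (by rwa [Ideal.mem_span_singleton])
  set φ := Ideal.Quotient.mk (Ideal.span {π}) with hφ
  have hcard : ∀ z : EisensteinInt, ((N z).natAbs : ℤ) = N z := fun z ↦
    Int.natAbs_of_nonneg (N_nonneg z)
  have hcardπ : (Fintype.card (EisensteinInt ⧸ Ideal.span {π}) : ℤ) = N π := by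
    rw [← Nat.card_eq_fintype_card, natCard_quotient, hcard]
  refine ⟨cubicJacobiSum φ h3', isPrimary_cubicJacobiSum φ h3', ?_, ?_⟩
  · have h1 : π ∣ cubicJacobiSum φ h3' := by
      rw [← Ideal.mem_span_singleton, ← Ideal.Quotient.eq_zero_iff_mem]
      exact map_cubicJacobiSum φ h3'
    obtain ⟨t, ht⟩ := h1
    have h2 := N_cubicJacobiSum φ h3'
    rw [hcardπ, ht, map_mul] at h2
    have h4 : N t = 1 := mul_left_cancel₀ (fun h ↦ hπ.ne_zero (N_eq_zero.1 h)) (by rw [h2, mul_one])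
    obtain ⟨u, hu⟩ := isUnit_iff_N.2 h4
    exact ⟨u, by rw [ht, hu]⟩
  · intro ρ hρ hρ3 hρπ
    have hm' := isMaximal_of_prime hρ
    have hfin' := finite_quotient hρ.ne_zero
    let _ := Ideal.Quotient.field (Ideal.span {ρ})
    have := Fintype.ofFinite (EisensteinInt ⧸ Ideal.span {ρ})
    have hcardρ : (Fintype.card (EisensteinInt ⧸ Ideal.span {ρ}) : ℤ) = N ρ := by
      rw [← Nat.card_eq_fintype_card, natCard_quotient, hcard]
    have h := cubicVal_mul_cubicVal_eq_one φ (Ideal.Quotient.mk (Ideal.span {ρ})) h3'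
      (three_ne_zero_quotient (by rwa [Ideal.mem_span_singleton])) (by
        rw [← map_natCast (Ideal.Quotient.mk (Ideal.span {ρ})), Ne,
          Ideal.Quotient.eq_zero_iff_mem, Ideal.mem_span_singleton, ← Int.cast_natCast, hcardπ]
        exact hρπ)
    rw [← hcardρ, ← hcardπ, Int.cast_natCast, Int.cast_natCast, idealSymbol, idealSymbol,
      map_natCast]
    exact h

end PrimeSymbol

open UniqueFactorizationMonoid

/-- The cubic Jacobi symbol `(a / b)₃`. -/
noncomputable def cubicSymbol (a b : EisensteinInt) : EisensteinInt :=
  ((factors b).map fun π ↦ idealSymbol (Ideal.span {π}) a).prod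

theorem cubicSymbol_of_isUnit (a : EisensteinInt) {u : EisensteinInt} (hu : IsUnit u) :
    cubicSymbol a u = 1 := by
  rw [cubicSymbol, factors_of_isUnit hu, Multiset.map_zero, Multiset.prod_zero]

theorem map_idealSymbol_eq_of_rel (a : EisensteinInt) {s t : Multiset EisensteinInt}
    (h : Multiset.Rel Associated s t) :
    s.map (fun π ↦ idealSymbol (Ideal.span {π}) a) =
      t.map fun π ↦ idealSymbol (Ideal.span {π}) a := by
  rw [← Multiset.rel_eq, Multiset.rel_map]
  refine h.mono fun π _ ρ _ hr ↦ ?_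
  rw [Ideal.span_singleton_eq_span_singleton.2 hr]

theorem cubicSymbol_mul_right (a : EisensteinInt) {b c : EisensteinInt} (hb : b ≠ 0) (hc : c ≠ 0) :
    cubicSymbol a (b * c) = cubicSymbol a b * cubicSymbol a c := by
  rw [cubicSymbol, map_idealSymbol_eq_of_rel a (factors_mul hb hc), Multiset.map_add,
    Multiset.prod_add, cubicSymbol, cubicSymbol]

theorem cubicSymbol_of_prime (a : EisensteinInt) {π : EisensteinInt} (hπ : Prime π) :
    cubicSymbol a π = idealSymbol (Ideal.span {π}) a := by
  have h : Multiset.Rel Associated (factors π) {π} :=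
    factors_unique irreducible_of_factor (fun x hx ↦ by
      rw [Multiset.mem_singleton.1 hx]; exact hπ.irreducible)
      (by rw [Multiset.prod_singleton]; exact factors_prod hπ.ne_zero)
  rw [cubicSymbol, map_idealSymbol_eq_of_rel a h, Multiset.map_singleton, Multiset.prod_singleton]

theorem not_isUnit_three : ¬ IsUnit (3 : EisensteinInt) := by
  rw [isUnit_iff_N, N_eq]
  decide

theorem ne_zero_of_isCoprime_three {b : EisensteinInt} (h : IsCoprime b 3) : b ≠ 0 := by
  rintro rfl
  exact not_isUnit_three (isCoprime_zero_left.1 h)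

/-- Induction over the Eisenstein integers which are coprime to `3`. -/
@[elab_as_elim]
theorem induction_of_isCoprime_three {P : EisensteinInt → Prop} {b : EisensteinInt}
    (hb : IsCoprime b 3) (hu : ∀ u, IsUnit u → P u)
    (hm : ∀ π b, Prime π → ¬ π ∣ 3 → IsCoprime b 3 → P b → P (π * b)) : P b := by
  revert hb
  refine induction_on_prime b (fun h ↦ absurd rfl (ne_zero_of_isCoprime_three h))
    (fun u h _ ↦ hu u h) fun b π _ hπ ih h ↦ ?_
  exact hm π b hπ (fun hd ↦ hπ.not_isUnit (h.of_mul_left_left.isUnit_of_dvd' dvd_rfl hd))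
    h.of_mul_left_right (ih h.of_mul_left_right)

theorem cubicSymbol_prime_mul (a : EisensteinInt) {π b : EisensteinInt} (hπ : Prime π)
    (hb : b ≠ 0) : cubicSymbol a (π * b) = idealSymbol (Ideal.span {π}) a * cubicSymbol a b := by
  rw [cubicSymbol_mul_right a hπ.ne_zero hb, cubicSymbol_of_prime a hπ]

theorem cubicSymbol_mul_left (a a' : EisensteinInt) {b : EisensteinInt} (hb : IsCoprime b 3) :
    cubicSymbol (a * a') b = cubicSymbol a b * cubicSymbol a' b := by
  refine induction_of_isCoprime_three hb (fun u hu ↦ ?_) fun π b hπ h3 hb ih ↦ ?_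
  · simp [cubicSymbol_of_isUnit _ hu]
  · have := isMaximal_of_prime hπ
    have := finite_quotient hπ.ne_zero
    have hb0 := ne_zero_of_isCoprime_three hb
    rw [cubicSymbol_prime_mul _ hπ hb0, cubicSymbol_prime_mul _ hπ hb0,
      cubicSymbol_prime_mul _ hπ hb0, ih, idealSymbol_mul (by rwa [Ideal.mem_span_singleton])]
    ring

theorem cubicSymbol_one_left {b : EisensteinInt} (hb : IsCoprime b 3) : cubicSymbol 1 b = 1 := by
  refine induction_of_isCoprime_three hb (fun u hu ↦ cubicSymbol_of_isUnit _ hu)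
    fun π b hπ h3 hb ih ↦ ?_
  have := isMaximal_of_prime hπ
  have := finite_quotient hπ.ne_zero
  rw [cubicSymbol_prime_mul _ hπ (ne_zero_of_isCoprime_three hb), ih,
    idealSymbol_one (by rwa [Ideal.mem_span_singleton]), one_mul]

theorem cubicSymbol_pow_left (a : EisensteinInt) {b : EisensteinInt} (hb : IsCoprime b 3) (n : ℕ) :
    cubicSymbol (a ^ n) b = cubicSymbol a b ^ n := by
  induction n with
  | zero => rw [pow_zero, pow_zero, cubicSymbol_one_left hb]
  | succ n ih => rw [pow_succ, pow_succ, cubicSymbol_mul_left _ _ hb, ih]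

theorem cubicSymbol_congr {a a' b : EisensteinInt} (hb : IsCoprime b 3) (h : b ∣ a - a') :
    cubicSymbol a b = cubicSymbol a' b := by
  revert h
  refine induction_of_isCoprime_three hb (fun u hu _ ↦ ?_) fun π b hπ h3 hb ih h ↦ ?_
  · rw [cubicSymbol_of_isUnit _ hu, cubicSymbol_of_isUnit _ hu]
  · have hb0 := ne_zero_of_isCoprime_three hb
    rw [cubicSymbol_prime_mul _ hπ hb0, cubicSymbol_prime_mul _ hπ hb0,
      ih (dvd_of_mul_left_dvd h), idealSymbol_congr]
    rw [Ideal.mem_span_singleton]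
    exact dvd_of_mul_right_dvd h

theorem notMem_span_of_isCoprime {a π : EisensteinInt} (hπ : Prime π) (h : IsCoprime a π) :
    a ∉ Ideal.span {π} := by
  rw [Ideal.mem_span_singleton]
  exact fun hd ↦ hπ.not_isUnit (h.isUnit_of_dvd' hd dvd_rfl)

theorem cubicSymbol_cube {a b : EisensteinInt} (hb : IsCoprime b 3) (h : IsCoprime a b) :
    cubicSymbol a b ^ 3 = 1 := by
  revert h
  refine induction_of_isCoprime_three hb (fun u hu _ ↦ ?_) fun π b hπ h3 hb ih h ↦ ?_
  · rw [cubicSymbol_of_isUnit _ hu, one_pow]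
  · rw [cubicSymbol_prime_mul _ hπ (ne_zero_of_isCoprime_three hb), mul_pow,
      ih h.of_mul_right_right,
      idealSymbol_cube (notMem_span_of_isCoprime hπ h.of_mul_right_left), one_mul]

theorem cubicSymbol_cube_left {a b : EisensteinInt} (hb : IsCoprime b 3) (h : IsCoprime a b) :
    cubicSymbol (a ^ 3) b = 1 := by
  rw [cubicSymbol_pow_left _ hb, cubicSymbol_cube hb h]

theorem cubicSymbol_neg_left (a : EisensteinInt) {b : EisensteinInt} (hb : IsCoprime b 3) :
    cubicSymbol (-a) b = cubicSymbol a b := by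
  have h : cubicSymbol (-1) b = 1 := by
    have := cubicSymbol_cube_left (a := -1) hb isCoprime_one_left.neg_left
    rwa [Odd.neg_one_pow (by decide)] at this
  rw [← neg_one_mul, cubicSymbol_mul_left _ _ hb, h, one_mul]

theorem prime_star {π : EisensteinInt} (hπ : Prime π) : Prime (star π) :=
  (MulEquiv.prime_iff (starRingAut : EisensteinInt ≃+* EisensteinInt).toMulEquiv).2 hπ

theorem idealSymbol_star {π a : EisensteinInt} (hπ : Prime π) (h3 : ¬ π ∣ 3) (ha : ¬ π ∣ a) :
    idealSymbol (Ideal.span {star π}) (star a) = star (idealSymbol (Ideal.span {π}) a) := by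
  have := isMaximal_of_prime hπ
  have := finite_quotient hπ.ne_zero
  have := isMaximal_of_prime (prime_star hπ)
  have := finite_quotient (prime_star hπ).ne_zero
  have hstar : ∀ {x : EisensteinInt}, π ∣ x → star π ∣ star x := by
    rintro x ⟨y, rfl⟩
    exact ⟨star y, by rw [star_mul']⟩
  have hstar' : ∀ {x : EisensteinInt}, star π ∣ star x → π ∣ x := by
    rintro x ⟨y, hy⟩
    exact ⟨star y, by rw [← star_star x, hy, star_mul', star_star]⟩
  refine (eq_idealSymbol ?_ ?_ ?_ ?_).symm
  · rw [Ideal.mem_span_singleton]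
    exact fun h ↦ h3 (hstar' (by rwa [star_ofNat]))
  · rw [Ideal.mem_span_singleton]
    exact fun h ↦ ha (hstar' h)
  · rw [← star_pow, idealSymbol_cube (by rwa [Ideal.mem_span_singleton]), star_one]
  · have h := pow_sub_idealSymbol_mem (I := Ideal.span {π}) (by rwa [Ideal.mem_span_singleton]) a
    rw [Ideal.mem_span_singleton] at h ⊢
    rw [natCard_quotient] at h ⊢
    rw [QuadraticAlgebra.norm_star, ← star_pow, ← star_sub]
    exact hstar h

theorem cubicSymbol_star {a b : EisensteinInt} (hb : IsCoprime b 3) (h : IsCoprime a b) :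
    cubicSymbol (star a) (star b) = star (cubicSymbol a b) := by
  revert h
  refine induction_of_isCoprime_three hb (fun u hu _ ↦ ?_) fun π b hπ h3 hb ih h ↦ ?_
  · rw [cubicSymbol_of_isUnit _ hu, cubicSymbol_of_isUnit _ hu.star, star_one]
  · have hb0 := ne_zero_of_isCoprime_three hb
    have ha := notMem_span_of_isCoprime hπ h.of_mul_right_left
    rw [Ideal.mem_span_singleton] at ha
    rw [star_mul', cubicSymbol_prime_mul _ hπ hb0,
      cubicSymbol_prime_mul _ (prime_star hπ) (star_ne_zero.2 hb0), star_mul',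
      ih h.of_mul_right_right, idealSymbol_star hπ h3 ha]

theorem star_intCast' (n : ℤ) : star (n : EisensteinInt) = n := by
  ext <;> simp

theorem isCoprime_intCast_three {n : ℤ} (hn : IsCoprime n 3) : IsCoprime (n : EisensteinInt) 3 := by
  have := hn.intCast (R := EisensteinInt)
  rwa [Int.cast_ofNat] at this

/-- Coprime rational integers are cubic residues of each other in `ℤ[ω]`. -/
theorem cubicSymbol_intCast_intCast {m n : ℤ} (hn : IsCoprime n 3) (h : IsCoprime m n) :
    cubicSymbol m n = 1 := by
  have hn' := isCoprime_intCast_three hn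
  have hc := h.intCast (R := EisensteinInt)
  have h1 := cubicSymbol_star hn' hc
  rw [star_intCast', star_intCast'] at h1
  have h3 := cubicSymbol_cube hn' hc
  have h2 := star_mul_self_of_cube_eq_one h3
  rw [← h1] at h2
  linear_combination h3 - cubicSymbol m n * h2

theorem idealSymbol_N_mul_cubicSymbol {π J : EisensteinInt} (hπ : Prime π) (h3 : ¬ π ∣ 3)
    (hJ : ∀ ρ, Prime ρ → ¬ ρ ∣ 3 → ¬ ρ ∣ (N π : EisensteinInt) →
      idealSymbol (Ideal.span {π}) (N ρ : EisensteinInt) *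
        idealSymbol (Ideal.span {ρ}) (N π * J) = 1)
    {b : EisensteinInt} (hb : IsCoprime b 3) (hbπ : IsCoprime b (N π : EisensteinInt)) :
    idealSymbol (Ideal.span {π}) (N b : EisensteinInt) * cubicSymbol (N π * J) b = 1 := by
  have := isMaximal_of_prime hπ
  have := finite_quotient hπ.ne_zero
  have h3' : (3 : EisensteinInt) ∉ Ideal.span {π} := by rwa [Ideal.mem_span_singleton]
  revert hbπ
  refine induction_of_isCoprime_three hb (fun u hu _ ↦ ?_) fun ρ b hρ hρ3 hb ih h ↦ ?_
  · rw [cubicSymbol_of_isUnit _ hu, isUnit_iff_N.1 hu, Int.cast_one, idealSymbol_one h3', one_mul]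
  · rw [cubicSymbol_prime_mul _ hρ (ne_zero_of_isCoprime_three hb), map_mul, Int.cast_mul,
      idealSymbol_mul h3']
    have h1 := ih h.of_mul_left_right
    have h2 := hJ ρ hρ hρ3 fun hd ↦ hρ.not_isUnit (h.of_mul_left_left.isUnit_of_dvd' dvd_rfl hd)
    rw [mul_mul_mul_comm, h2, h1, one_mul]

theorem N_intCast (n : ℤ) : N n = n ^ 2 := by
  simp

theorem isCoprime_of_isCoprime_N {a : EisensteinInt} {n : ℤ} (h : IsCoprime (N a) n) :
    IsCoprime a n := by
  have := h.intCast (R := EisensteinInt)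
  rw [← mul_star_eq_N] at this
  exact this.of_mul_left_left

theorem exists_primary_associated_cubicSymbol_eq_idealSymbol {π : EisensteinInt} (hπ : Prime π)
    (h3 : ¬ π ∣ 3) : ∃ J, IsPrimary J ∧ Associated π J ∧ ∀ n : ℤ, IsCoprime n 3 →
      IsCoprime (N π) n → cubicSymbol J n = idealSymbol (Ideal.span {π}) n := by
  obtain ⟨J, hJ, hπJ, h⟩ := exists_primary_associated hπ h3
  refine ⟨J, hJ, hπJ, fun n hn hc ↦ ?_⟩
  have := isMaximal_of_prime hπ
  have := finite_quotient hπ.ne_zero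
  have h3' : (3 : EisensteinInt) ∉ Ideal.span {π} := by rwa [Ideal.mem_span_singleton]
  have hn' := isCoprime_intCast_three hn
  have h1 := idealSymbol_N_mul_cubicSymbol hπ h3 h hn' (hc.intCast (R := EisensteinInt)).symm
  rw [N_intCast, cubicSymbol_mul_left _ _ hn', cubicSymbol_intCast_intCast hn hc, one_mul,
    Int.cast_pow, sq, idealSymbol_mul h3'] at h1
  have h2 := idealSymbol_cube (notMem_span_of_isCoprime hπ (isCoprime_of_isCoprime_N hc).symm)
  linear_combination idealSymbol (Ideal.span {π}) n * h1 - cubicSymbol J n * h2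

theorem IsPrimary.mul {a b : EisensteinInt} (ha : IsPrimary a) (hb : IsPrimary b) :
    IsPrimary (a * b) := by
  obtain ⟨⟨k, hk⟩, ha⟩ := ha
  obtain ⟨⟨l, hl⟩, hb⟩ := hb
  have him : (a * b).im = 3 * (a.re * l + k * b.re - 3 * (k * l)) := by
    simp [hk, hl]; ring
  have hre : (a * b).re = a.re * b.re - 3 * (3 * (k * l)) := by
    simp [hk, hl]; ring
  refine ⟨him ▸ dvd_mul_right _ _, fun h ↦ ?_⟩
  rw [hre, dvd_sub_left (dvd_mul_right _ _)] at h
  exact (Int.prime_three.dvd_or_dvd h).elim ha hb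

theorem exists_primary_associated_cubicSymbol_eq {n : ℤ} (hn : IsCoprime n 3) {b : EisensteinInt}
    (hb : IsCoprime b 3) (hc : IsCoprime (N b) n) :
    ∃ c, IsPrimary c ∧ Associated b c ∧ cubicSymbol c n = cubicSymbol n b := by
  have hn' := isCoprime_intCast_three hn
  revert hc
  refine induction_of_isCoprime_three hb (fun u hu _ ↦ ?_) fun π b hπ h3 hb ih h ↦ ?_
  · refine ⟨1, ⟨by simp, by simp⟩, associated_one_iff_isUnit.2 hu, ?_⟩
    rw [cubicSymbol_of_isUnit _ hu, cubicSymbol_one_left hn']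
  · rw [map_mul] at h
    obtain ⟨c, hc, hbc, hc'⟩ := ih h.of_mul_left_right
    obtain ⟨J, hJ, hπJ, hJ'⟩ := exists_primary_associated_cubicSymbol_eq_idealSymbol hπ h3
    refine ⟨J * c, hJ.mul hc, hπJ.mul_mul hbc, ?_⟩
    rw [cubicSymbol_mul_left _ _ hn', cubicSymbol_prime_mul _ hπ (ne_zero_of_isCoprime_three hb),
      hc', hJ' n hn h.of_mul_left_left]

theorem IsPrimary.isCoprime_three {b : EisensteinInt} (hb : IsPrimary b) : IsCoprime b 3 := by
  obtain ⟨⟨k, hk⟩, h⟩ := hb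
  have h1 : IsCoprime (N b) 3 := by
    rw [isCoprime_comm, Int.prime_three.coprime_iff_not_dvd, N_eq, hk]
    intro hd
    have : b.re ^ 2 = b.re ^ 2 - b.re * (3 * k) + (3 * k) ^ 2 + 3 * (b.re * k - 3 * k ^ 2) := by
      ring
    have h2 : (3 : ℤ) ∣ b.re ^ 2 := by
      rw [this]
      exact dvd_add hd (dvd_mul_right _ _)
    exact h (Int.prime_three.dvd_of_dvd_pow h2)
  simpa using isCoprime_of_isCoprime_N h1

/-- Cubic reciprocity between a primary Eisenstein integer and a rational integer. -/
theorem IsPrimary.cubicSymbol_eq {b : EisensteinInt} (hb : IsPrimary b) {n : ℤ}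
    (hn : IsCoprime n 3) (hc : IsCoprime (N b) n) : cubicSymbol b n = cubicSymbol n b := by
  obtain ⟨c, hc, hbc, h⟩ := exists_primary_associated_cubicSymbol_eq hn hb.isCoprime_three hc
  rcases hb.eq_or_eq_neg hc hbc with rfl | rfl
  · exact h
  · rwa [cubicSymbol_neg_left _ (isCoprime_intCast_three hn)] at h

theorem three_ne_zero_zmod {p : ℕ} [hp : Fact p.Prime] (hp3 : p % 3 = 1) :
    (3 : ZMod p) ≠ 0 := by
  have h : ((3 : ℕ) : ZMod p) ≠ 0 := by
    rw [Ne, ZMod.natCast_eq_zero_iff, Nat.prime_dvd_prime_iff_eq hp.out Nat.prime_three]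
    rintro rfl
    simp at hp3
  exact_mod_cast h

/-- The cubic symbol modulo a split prime `p` compares the cubic characters of an element and its
conjugate. -/
theorem cubicSymbol_natCast_eq_one_iff {p : ℕ} [hp : Fact p.Prime] (hp3 : (3 : ZMod p) ≠ 0)
    (φ : EisensteinInt →+* ZMod p) {b : EisensteinInt} (hb : IsCoprime (N b) p) :
    cubicSymbol b p = 1 ↔ φ b ^ ((p - 1) / 3) = φ (star b) ^ ((p - 1) / 3) := by
  have hsurj : Function.Surjective φ := ZMod.ringHom_surjective φ
  obtain ⟨π, hπ⟩ := (inferInstance : (RingHom.ker φ).IsPrincipal)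
  rw [Ideal.submodule_span_eq] at hπ
  have hmem : ∀ {x}, φ x = 0 ↔ π ∣ x := by
    intro x
    rw [← RingHom.mem_ker, hπ, Ideal.mem_span_singleton]
  have hcard : Nat.card (EisensteinInt ⧸ Ideal.span {π}) = p := by
    rw [← hπ, Nat.card_congr (RingHom.quotientKerEquivOfSurjective hsurj).toEquiv,
      Nat.card_zmod]
  have hNπ : N π = p := by
    rw [← Int.natAbs_of_nonneg (N_nonneg π), ← natCard_quotient, hcard]
  have hπ0 : π ≠ 0 := by
    rintro rfl
    rw [N_eq_zero.2 rfl] at hNπ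
    exact hp.out.ne_zero (by exact_mod_cast hNπ.symm)
  have hprime : Prime π := by
    rw [← Ideal.span_singleton_prime hπ0, ← hπ]
    exact RingHom.ker_isPrime φ
  have h3 : ¬ π ∣ 3 := by
    rw [← hmem, map_ofNat]
    exact hp3
  have hcop := isCoprime_of_isCoprime_N hb
  have hcop' : IsCoprime (star b) (p : ℤ) := isCoprime_of_isCoprime_N (by
    rwa [QuadraticAlgebra.norm_star])
  rw [← hNπ, ← mul_star_eq_N] at hcop hcop'
  have hbπ := notMem_span_of_isCoprime hprime hcop.of_mul_right_left
  have hbπ' := notMem_span_of_isCoprime hprime hcop'.of_mul_right_left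
  have h1 : cubicSymbol b p =
      idealSymbol (Ideal.span {π}) b * star (idealSymbol (Ideal.span {π}) (star b)) := by
    rw [← Int.cast_natCast, ← hNπ, ← mul_star_eq_N,
      cubicSymbol_prime_mul _ hprime (star_ne_zero.2 hπ0),
      cubicSymbol_of_prime _ (prime_star hprime),
      ← idealSymbol_star hprime h3 (by rwa [← Ideal.mem_span_singleton]), star_star]
  have := isMaximal_of_prime hprime
  have := finite_quotient hπ0
  have hφ : ∀ x, φ (idealSymbol (Ideal.span {π}) x) = φ x ^ ((p - 1) / 3) := by
    intro x
    have h := pow_sub_idealSymbol_mem (I := Ideal.span {π}) (by rwa [Ideal.mem_span_singleton]) x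
    rw [hcard, Ideal.mem_span_singleton, ← hmem, map_sub, map_pow, sub_eq_zero] at h
    exact h.symm
  have hs := idealSymbol_cube hbπ
  have hs' := idealSymbol_cube hbπ'
  have h2 := star_mul_self_of_cube_eq_one hs'
  rw [h1, ← hφ, ← hφ]
  constructor
  · intro h
    congr 1
    linear_combination idealSymbol (Ideal.span {π}) (star b) * h -
      idealSymbol (Ideal.span {π}) b * h2
  · intro h
    rw [eq_of_cube_eq_one_of_map_eq φ hp3 hs hs' h, mul_comm]
    exact h2

/-- The square root `1 + 2 ω` of `-3`. -/
def theta : EisensteinInt := ⟨1, 2⟩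

theorem theta_pow_three : theta ^ 3 = -(3 * theta) := by
  ext <;> simp [theta, pow_succ]

theorem isCoprime_theta {b : EisensteinInt} (hb : IsCoprime b 3) : IsCoprime theta b := by
  have h : (3 : EisensteinInt) = -(theta * theta) := by
    ext <;> simp [theta]
  rw [h, IsCoprime.neg_right_iff] at hb
  exact hb.of_mul_right_left.symm

theorem cubicSymbol_three_mul_theta_mul (a : EisensteinInt) {b : EisensteinInt}
    (hb : IsCoprime b 3) : cubicSymbol (3 * theta * a) b = cubicSymbol a b := by
  have h : 3 * theta * a = -(theta ^ 3 * a) := by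
    rw [theta_pow_three]; ring
  rw [h, cubicSymbol_neg_left _ hb, cubicSymbol_mul_left _ _ hb,
    cubicSymbol_cube_left hb (isCoprime_theta hb), one_mul]

theorem isCoprime_three_of_not_dvd {n : ℤ} (h : ¬ 3 ∣ n) : IsCoprime n 3 :=
  ((Int.prime_three.coprime_iff_not_dvd).2 h).symm

theorem isCoprime_of_prime_eq_form {p : ℕ} (hp : p.Prime) {x y a b c : ℤ}
    (h : (p : ℤ) = a * x ^ 2 + b * (x * y) + c * y ^ 2) : IsCoprime x y := by
  rw [Int.isCoprime_iff_gcd_eq_one]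
  have hd : ((Int.gcd x y : ℕ) : ℤ) * (Int.gcd x y : ℕ) ∣ p := by
    obtain ⟨u, hu⟩ := Int.gcd_dvd_left x y
    obtain ⟨v, hv⟩ := Int.gcd_dvd_right x y
    refine ⟨a * u ^ 2 + b * (u * v) + c * v ^ 2, ?_⟩
    rw [h]
    generalize ((Int.gcd x y : ℕ) : ℤ) = g at *
    rw [hu, hv]; ring
  have := (Nat.prime_iff_prime_int.1 hp).squarefree _ hd
  rwa [Int.ofNat_isUnit, Nat.isUnit_iff] at this

theorem isCoprime_natCast_three {p : ℕ} (hp3 : p % 3 = 1) : IsCoprime (p : ℤ) 3 :=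
  isCoprime_three_of_not_dvd (by omega)

theorem isCoprime_of_eq_form {n x y a b c : ℤ} (h : n = a * x ^ 2 + b * (x * y) + c * y ^ 2)
    (hn : IsCoprime a y) (hxy : IsCoprime x y) : IsCoprime y n := by
  have : n = a * x ^ 2 + y * (b * x + c * y) := by rw [h]; ring
  rw [this]
  exact ((hn.mul_left hxy.pow_left).symm).add_mul_left_right _

theorem cubicSymbol_eq_one_of_not_three_dvd_sub {p : ℕ} (hp : p.Prime) (hp3 : p % 3 = 1)
    {x y : ℤ} (h : (p : ℤ) = x ^ 2 + x * y + 8 * y ^ 2) (hxy3 : ¬ 3 ∣ x - y) :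
    IsCoprime (N ⟨x - y, -3 * y⟩) p ∧ cubicSymbol ⟨x - y, -3 * y⟩ p = 1 := by
  have h' : (p : ℤ) = 1 * x ^ 2 + 1 * (x * y) + 8 * y ^ 2 := by rw [h]; ring
  have hxy := isCoprime_of_prime_eq_form hp h'
  have hyp := isCoprime_of_eq_form h' isCoprime_one_left hxy
  set γ : EisensteinInt := ⟨x - y, -3 * y⟩ with hγ
  have hprim : IsPrimary γ := ⟨⟨-y, by simp [hγ]⟩, hxy3⟩
  have hN : N γ = p - y ^ 2 := by
    rw [N_eq, h]; simp only [hγ]; ring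
  have hp3' := isCoprime_natCast_three hp3
  have hγ3 := hprim.isCoprime_three
  have hcop : IsCoprime (N γ) p := by
    rw [hN, isCoprime_comm, show (p : ℤ) - y ^ 2 = -(y ^ 2) + p * 1 by ring]
    exact (hyp.pow_left.symm.neg_right).add_mul_left_right _
  refine ⟨hcop, ?_⟩
  have h1 : cubicSymbol γ (p : ℤ) = cubicSymbol (p : ℤ) γ := hprim.cubicSymbol_eq hp3' hcop
  have h2 : cubicSymbol (p : ℤ) γ = cubicSymbol y γ ^ 2 := by
    rw [← cubicSymbol_pow_left _ hγ3]
    refine cubicSymbol_congr hγ3 ⟨star γ, ?_⟩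
    rw [mul_star_eq_N, hN]; push_cast; ring
  have hs3 : IsCoprime (2 * x + y) 3 := isCoprime_three_of_not_dvd (by omega)
  have hxs : IsCoprime x (2 * x + y) := by
    rw [show 2 * x + y = y + x * 2 by ring]
    exact hxy.add_mul_left_right _
  have h3 : cubicSymbol (2 * x + y : ℤ) γ = cubicSymbol y γ := by
    rw [← cubicSymbol_three_mul_theta_mul (y : EisensteinInt) hγ3]
    refine cubicSymbol_congr hγ3 ⟨2, ?_⟩
    ext <;> simp [hγ, theta] <;> ring
  have h4 : cubicSymbol γ (2 * x + y : ℤ) = cubicSymbol (2 * x + y : ℤ) γ := by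
    refine hprim.cubicSymbol_eq hs3 ?_
    rw [hN, h, isCoprime_comm, show x ^ 2 + x * y + 8 * y ^ 2 - y ^ 2 =
      3 ^ 3 * x ^ 2 + (2 * x + y) * (7 * y - 13 * x) by ring]
    exact (hs3.pow_right.mul_right hxs.symm.pow_right).add_mul_left_right _
  have hs3' := isCoprime_intCast_three hs3
  have h5 : cubicSymbol γ (2 * x + y : ℤ) = 1 := by
    rw [← cubicSymbol_intCast_intCast hs3 hxs,
      ← cubicSymbol_three_mul_theta_mul (x : EisensteinInt) hs3']
    refine cubicSymbol_congr hs3' ⟨⟨-1, -3⟩, ?_⟩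
    ext <;> simp [hγ, theta] <;> ring
  rw [Int.cast_natCast] at h1
  rw [h1, ← Int.cast_natCast, h2, ← h3, ← h4, h5, one_pow]

theorem cubicSymbol_eq_one_of_three_dvd_sub {p : ℕ} (hp : p.Prime) (hp3 : p % 3 = 1)
    {x y : ℤ} (h : (p : ℤ) = x ^ 2 + x * y + 8 * y ^ 2) (hxy3 : 3 ∣ x - y) :
    IsCoprime (N ⟨16 * y + 3 * x, 3 * (2 * x + y)⟩) p ∧
      cubicSymbol ⟨16 * y + 3 * x, 3 * (2 * x + y)⟩ p = 1 := by
  have h' : (p : ℤ) = 1 * x ^ 2 + 1 * (x * y) + 8 * y ^ 2 := by rw [h]; ring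
  have hxy := isCoprime_of_prime_eq_form hp h'
  have hyp := isCoprime_of_eq_form h' isCoprime_one_left hxy
  have hp3' := isCoprime_natCast_three hp3
  have hy : ¬ 3 ∣ y := by
    rintro ⟨k, hk⟩
    obtain ⟨l, hl⟩ := hxy3
    have hx : x = 3 * (l + k) := by omega
    have : (p : ℤ) = 3 * (3 * ((l + k) ^ 2 + (l + k) * k + 8 * k ^ 2)) := by
      rw [h, hx, hk]; ring
    omega
  have hy3 := isCoprime_three_of_not_dvd hy
  set γ : EisensteinInt := ⟨16 * y + 3 * x, 3 * (2 * x + y)⟩ with hγ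
  have hprim : IsPrimary γ := ⟨dvd_mul_right _ _, by simp only [hγ]; omega⟩
  have hN : N γ = 3 ^ 3 * p + y ^ 2 := by
    rw [N_eq, h]; simp only [hγ]; ring
  have hγ3 := hprim.isCoprime_three
  have hcop : IsCoprime (N γ) p := by
    rw [hN, isCoprime_comm, show (3 : ℤ) ^ 3 * p + y ^ 2 = y ^ 2 + p * 3 ^ 3 by ring]
    exact (hyp.pow_left.symm).add_mul_left_right _
  refine ⟨hcop, ?_⟩
  have h1 : cubicSymbol γ (p : ℤ) = cubicSymbol (p : ℤ) γ := hprim.cubicSymbol_eq hp3' hcop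
  have h2 : cubicSymbol (p : ℤ) γ = cubicSymbol y γ ^ 2 := by
    have h3 := cubicSymbol_cube_left hγ3 hγ3.symm
    rw [← cubicSymbol_pow_left _ hγ3, ← cubicSymbol_neg_left (_ ^ 2) hγ3,
      ← one_mul (cubicSymbol (p : ℤ) γ), ← h3, ← cubicSymbol_mul_left _ _ hγ3]
    refine cubicSymbol_congr hγ3 ⟨star γ, ?_⟩
    rw [mul_star_eq_N, hN]; push_cast; ring
  have h4 : cubicSymbol γ y = cubicSymbol y γ := by
    refine hprim.cubicSymbol_eq hy3 ?_
    rw [hN, isCoprime_comm, show (3 : ℤ) ^ 3 * p + y ^ 2 = 3 ^ 3 * p + y * y by ring]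
    exact (hy3.pow_right.mul_right hyp).add_mul_left_right _
  have hy3' := isCoprime_intCast_three hy3
  have h5 : cubicSymbol γ y = 1 := by
    rw [← cubicSymbol_intCast_intCast hy3 hxy,
      ← cubicSymbol_three_mul_theta_mul (x : EisensteinInt) hy3']
    refine cubicSymbol_congr hy3' ⟨⟨16, 3⟩, ?_⟩
    ext <;> simp [hγ, theta] <;> ring
  rw [Int.cast_natCast] at h1
  rw [h1, ← Int.cast_natCast, h2, ← h4, h5, one_pow]

theorem prime_two : Prime (2 : EisensteinInt) := by
  have h2 : ∀ z : EisensteinInt, (2 : EisensteinInt) ∣ z ↔ 2 ∣ N z := by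
    intro z
    rw [← Int.cast_ofNat (R := EisensteinInt), intCast_dvd_iff, N_eq]
    constructor
    · rintro ⟨⟨a, ha⟩, ⟨b, hb⟩⟩
      refine ⟨2 * a ^ 2 - 2 * a * b + 2 * b ^ 2, ?_⟩
      rw [ha, hb]; ring
    · intro h
      rcases Int.even_or_odd' z.re with ⟨a, ha | ha⟩ <;>
      rcases Int.even_or_odd' z.im with ⟨b, hb | hb⟩ <;> rw [ha, hb] at h ⊢ <;>
      ring_nf at h <;> omega
  refine ⟨two_ne_zero, ?_, fun a b h ↦ ?_⟩
  · rw [isUnit_iff_N, N_eq]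
    decide
  · rw [h2, map_mul] at h
    rw [h2, h2]
    exact Int.prime_two.dvd_or_dvd h

theorem cubicSymbol_w_two : cubicSymbol w 2 = w := by
  have := isMaximal_of_prime prime_two
  have := finite_quotient prime_two.ne_zero
  have h2 : IsCoprime (2 : EisensteinInt) 3 := ⟨-1, 1, by norm_num⟩
  rw [cubicSymbol_of_prime _ prime_two]
  refine (eq_idealSymbol ?_ ?_ w_cube ?_).symm
  · exact notMem_span_of_isCoprime prime_two h2.symm
  · exact notMem_span_of_isCoprime prime_two ⟨w ^ 2, 0, by rw [← pow_succ, w_cube]; ring⟩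
  · rw [natCard_quotient, N_eq]
    have : ((2 : EisensteinInt).re ^ 2 - (2 : EisensteinInt).re * (2 : EisensteinInt).im +
      (2 : EisensteinInt).im ^ 2).natAbs = 4 := by decide
    rw [this]
    simp

theorem cubicSymbol_ne_one {p : ℕ} (hp : p.Prime) (hp3 : p % 3 = 1)
    {x y : ℤ} (h : (p : ℤ) = 2 * x ^ 2 + x * y + 4 * y ^ 2) :
    IsCoprime (N ⟨2 * x - y, -3 * y⟩) p ∧ cubicSymbol ⟨2 * x - y, -3 * y⟩ p ≠ 1 := by
  have h' : (p : ℤ) = 2 * x ^ 2 + 1 * (x * y) + 4 * y ^ 2 := by rw [h]; ring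
  have hxy := isCoprime_of_prime_eq_form hp h'
  have hp3' := isCoprime_natCast_three hp3
  have hyodd : y % 2 = 1 := by
    by_contra hy
    obtain ⟨k, hk⟩ : (2 : ℤ) ∣ y := by omega
    have h2 : (p : ℤ) = 2 * (x ^ 2 + x * k + 2 * y ^ 2) := by rw [h]; nth_rw 1 [hk]; ring
    have h3 : 2 ∣ p := by omega
    rw [Nat.prime_dvd_prime_iff_eq Nat.prime_two hp] at h3
    omega
  have hy2 : IsCoprime 2 y := by
    rw [Int.prime_two.coprime_iff_not_dvd]; omega
  have hyp := isCoprime_of_eq_form h' hy2 hxy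
  have key : ¬ 3 ∣ y ∧ ¬ 3 ∣ 2 * x - y := by
    have hp3'' : (p : ℤ) % 3 = 1 := by omega
    obtain ⟨k, a, hx, ha⟩ : ∃ k a : ℤ, x = 3 * k + a ∧ (a = 0 ∨ a = 1 ∨ a = 2) :=
      ⟨x / 3, x % 3, by omega, by omega⟩
    obtain ⟨l, b, hy, hb⟩ : ∃ k a : ℤ, y = 3 * k + a ∧ (a = 0 ∨ a = 1 ∨ a = 2) :=
      ⟨y / 3, y % 3, by omega, by omega⟩
    have h4 : (p : ℤ) = 2 * a ^ 2 + a * b + 4 * b ^ 2 + 3 * (6 * k ^ 2 + 4 * k * a + 3 * k * l +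
      k * b + l * a + 12 * l ^ 2 + 8 * l * b) := by rw [h, hx, hy]; ring
    generalize 6 * k ^ 2 + 4 * k * a + 3 * k * l + k * b + l * a + 12 * l ^ 2 + 8 * l * b = t at h4
    rcases ha with rfl | rfl | rfl <;> rcases hb with rfl | rfl | rfl <;> omega
  have hy3 := isCoprime_three_of_not_dvd key.1
  set γ : EisensteinInt := ⟨2 * x - y, -3 * y⟩ with hγ
  have hprim : IsPrimary γ := ⟨⟨-y, by simp [hγ]⟩, key.2⟩
  have hN : N γ = 2 * p - y ^ 2 := by
    rw [N_eq, h]; simp only [hγ]; ring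
  have hγ3 := hprim.isCoprime_three
  have hcop : IsCoprime (N γ) p := by
    rw [hN, isCoprime_comm, show 2 * (p : ℤ) - y ^ 2 = -(y ^ 2) + p * 2 by ring]
    exact (hyp.pow_left.symm.neg_right).add_mul_left_right _
  refine ⟨hcop, ?_⟩
  have h1 : cubicSymbol γ (p : ℤ) = cubicSymbol (p : ℤ) γ := hprim.cubicSymbol_eq hp3' hcop
  have h2 : cubicSymbol (2 : ℤ) γ * cubicSymbol (p : ℤ) γ = cubicSymbol y γ ^ 2 := by
    rw [← cubicSymbol_pow_left _ hγ3, ← cubicSymbol_mul_left _ _ hγ3]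
    refine cubicSymbol_congr hγ3 ⟨star γ, ?_⟩
    rw [mul_star_eq_N, hN]; push_cast; ring
  have h4 : cubicSymbol γ y = cubicSymbol y γ := by
    refine hprim.cubicSymbol_eq hy3 ?_
    rw [hN, isCoprime_comm, show 2 * (p : ℤ) - y ^ 2 = 2 * p + y * -y by ring]
    exact (hy2.symm.mul_right hyp).add_mul_left_right _
  have h5 : cubicSymbol γ y = 1 := by
    rw [← cubicSymbol_intCast_intCast hy3 (hy2.mul_left hxy)]
    refine cubicSymbol_congr (isCoprime_intCast_three hy3) ⟨⟨-1, -3⟩, ?_⟩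
    ext <;> simp [hγ]
    ring
  have h23 : IsCoprime (2 : ℤ) 3 := ⟨-1, 1, by norm_num⟩
  have h6 : cubicSymbol γ (2 : ℤ) = cubicSymbol (2 : ℤ) γ := by
    refine hprim.cubicSymbol_eq h23 ?_
    rw [hN, isCoprime_comm, show 2 * (p : ℤ) - y ^ 2 = -(y ^ 2) + 2 * p by ring]
    exact hy2.pow_right.neg_right.add_mul_left_right _
  have h7 : cubicSymbol γ (2 : ℤ) = w ^ 2 := by
    have h23' := isCoprime_intCast_three h23
    rw [← cubicSymbol_w_two, ← Int.cast_ofNat (R := EisensteinInt) 2,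
      ← cubicSymbol_pow_left _ h23']
    refine cubicSymbol_congr h23' ?_
    rw [intCast_dvd_iff, w_sq]
    simp [hγ, w]
    omega
  rw [Int.cast_natCast] at h1
  rw [h1, ← Int.cast_natCast]
  intro h8
  rw [h8, ← h6, h7, ← h4, h5] at h2
  have := congrArg QuadraticAlgebra.re h2
  rw [w_sq] at this
  simp [w] at this

end EisensteinInt

/-- A positive definite binary quadratic form of discriminant `-31` only takes values which are
taken by `x ^ 2 + x y + 8 y ^ 2` or `2 x ^ 2 + x y + 4 y ^ 2`. -/
theorem exists_eq_reduced_form_of_discrim {a b c n : ℤ} (ha : 0 < a)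
    (hd : b ^ 2 - 4 * a * c = -31) {u v : ℤ} (hn : n = a * u ^ 2 + b * (u * v) + c * v ^ 2) :
    (∃ x y : ℤ, n = x ^ 2 + x * y + 8 * y ^ 2) ∨
      ∃ x y : ℤ, n = 2 * x ^ 2 + x * y + 4 * y ^ 2 := by
  induction hk : a.toNat using Nat.strong_induction_on generalizing a b c u v with
  | _ k ih =>
  obtain ⟨t, ht⟩ : ∃ t, |b + 2 * a * t| ≤ a := by
    refine ⟨-((b + a) / (2 * a)), ?_⟩
    have h1 := Int.emod_add_mul_ediv (b + a) (2 * a)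
    have h2 := Int.emod_nonneg (b + a) (by positivity : 2 * a ≠ 0)
    have h3 := Int.emod_lt_of_pos (b + a) (by positivity : 0 < 2 * a)
    rw [abs_le]
    constructor <;> linarith
  set b' := b + 2 * a * t with hb'
  set c' := a * t ^ 2 + b * t + c with hc'
  have hd' : b' ^ 2 - 4 * a * c' = -31 := by rw [hb', hc', ← hd]; ring
  have hn' : n = a * (u - t * v) ^ 2 + b' * ((u - t * v) * v) + c' * v ^ 2 := by
    rw [hb', hc', hn]; ring
  generalize u - t * v = u' at hn'
  have hb2 : b' ^ 2 ≤ a ^ 2 := sq_le_sq' (abs_le.1 ht).1 (abs_le.1 ht).2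
  have hc0 : 0 < c' := by
    by_contra! h
    nlinarith [sq_nonneg b']
  by_cases hlt : c' < a
  · exact ih c'.toNat (by omega) hc0 (b := b') (c := a) (u := v) (v := u')
      (by rw [← hd']; ring) (by rw [hn']; ring) rfl
  · have ha3 : a ≤ 3 := by
      by_contra! h
      nlinarith
    obtain ⟨h1, h2⟩ := abs_le.1 ht
    clear_value b' c'
    have : a = 1 ∨ a = 2 ∨ a = 3 := by omega
    rcases this with rfl | rfl | rfl
    · have : b' = -1 ∨ b' = 0 ∨ b' = 1 := by omega
      rcases this with rfl | rfl | rfl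
      · obtain rfl : c' = 8 := by omega
        exact Or.inl ⟨-u', v, by rw [hn']; ring⟩
      · omega
      · obtain rfl : c' = 8 := by omega
        exact Or.inl ⟨u', v, by rw [hn']; ring⟩
    · have : b' = -2 ∨ b' = -1 ∨ b' = 0 ∨ b' = 1 ∨ b' = 2 := by omega
      rcases this with rfl | rfl | rfl | rfl | rfl
      · omega
      · obtain rfl : c' = 4 := by omega
        exact Or.inr ⟨-u', v, by rw [hn']; ring⟩
      · omega
      · obtain rfl : c' = 4 := by omega
        exact Or.inr ⟨u', v, by rw [hn']; ring⟩
      · omega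
    · have : b' = -3 ∨ b' = -2 ∨ b' = -1 ∨ b' = 0 ∨ b' = 1 ∨ b' = 2 ∨ b' = 3 := by omega
      rcases this with rfl | rfl | rfl | rfl | rfl | rfl | rfl <;> omega

theorem Nat.Prime.exists_eq_form_of_isSquare_neg_thirtyOne {p : ℕ} (hp : p.Prime) (hp2 : p % 2 = 1)
    (h : IsSquare (-31 : ZMod p)) :
    (∃ x y : ℤ, (p : ℤ) = x ^ 2 + x * y + 8 * y ^ 2) ∨
      ∃ x y : ℤ, (p : ℤ) = 2 * x ^ 2 + x * y + 4 * y ^ 2 := by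
  obtain ⟨b₀, hb₀⟩ := h
  obtain ⟨b, rfl⟩ := ZMod.intCast_surjective b₀
  obtain ⟨b, hb, hodd⟩ : ∃ b : ℤ, (p : ℤ) ∣ b * b + 31 ∧ b % 2 = 1 := by
    have h1 : (p : ℤ) ∣ b * b + 31 := by
      rw [← ZMod.intCast_zmod_eq_zero_iff_dvd]
      push_cast
      rw [← hb₀]; ring
    rcases Int.emod_two_eq_zero_or_one b with h0 | h0
    · refine ⟨b + p, ?_, by omega⟩
      have : (b + p) * (b + p) + 31 = b * b + 31 + p * (2 * b + p) := by ring
      rw [this]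
      exact dvd_add h1 (dvd_mul_right _ _)
    · exact ⟨b, h1, h0⟩
  have h4 : (4 : ℤ) ∣ b * b + 31 := by
    obtain ⟨k, rfl⟩ : ∃ k, b = 2 * k + 1 := ⟨b / 2, by omega⟩
    exact ⟨k * k + k + 8, by ring⟩
  have hcop : IsCoprime (4 : ℤ) p := by
    rw [show (4 : ℤ) = 2 ^ 2 by norm_num]
    refine IsCoprime.pow_left ?_
    rw [Int.prime_two.coprime_iff_not_dvd]
    omega
  obtain ⟨c, hc⟩ := hcop.mul_dvd h4 hb
  exact exists_eq_reduced_form_of_discrim (a := p) (b := b) (c := c) (u := 1) (v := 0)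
    (by exact_mod_cast hp.pos) (by linarith) (by ring)

namespace EisensteinInt

open QuadraticAlgebra hiding norm

section ZMod

variable {p : ℕ} [hp : Fact p.Prime]

/-- The ring homomorphism from `ℤ[ω]` given by a root of `X ^ 2 + X + 1`. -/
theorem exists_ringHom {R : Type*} [CommRing R] {r : R} (hr : r ^ 2 + r + 1 = 0) :
    ∃ φ : EisensteinInt →+* R, ∀ b, φ b = b.re + b.im * r := by
  let f : EisensteinInt →ₐ[ℤ] R := QuadraticAlgebra.lift ⟨r, by
    simp only [neg_smul, one_smul]; linear_combination hr⟩
  refine ⟨f, fun b ↦ ?_⟩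
  simp [f]

theorem pow_two_mul_eq_one_iff {e : ZMod p} (he : e ≠ 0) {m : ℕ} (hm : p - 1 = m * 3) :
    (e ^ 2) ^ m = 1 ↔ e ^ m = 1 := by
  have h1 : e ^ m * e ^ m * e ^ m = 1 := by
    rw [← ZMod.pow_card_sub_one_eq_one he, hm]; ring
  constructor
  · intro h
    have h2 : e ^ m * e ^ m = 1 := by rw [← h]; ring
    rwa [h2, one_mul] at h1
  · intro h
    rw [← pow_mul, mul_comm, pow_mul, h, one_pow]

theorem pow_eq_pow_iff_of_eq_mul {A B e : ZMod p} (hB : B ≠ 0) (h : A = e * B) (m : ℕ) :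
    A ^ m = B ^ m ↔ e ^ m = 1 := by
  rw [h, mul_pow, mul_eq_right₀ (pow_ne_zero _ hB)]

theorem two_ne_zero_zmod (hp3 : p % 3 = 1) : (2 : ZMod p) ≠ 0 := by
  have h : ((2 : ℕ) : ZMod p) ≠ 0 := by
    rw [Ne, ZMod.natCast_eq_zero_iff, Nat.prime_dvd_prime_iff_eq hp.out Nat.prime_two]
    rintro rfl
    simp at hp3
  exact_mod_cast h

theorem map_ne_zero_of_isCoprime_N (φ : EisensteinInt →+* ZMod p) {b : EisensteinInt}
    (hb : IsCoprime (N b) p) : φ b ≠ 0 ∧ φ (star b) ≠ 0 := by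
  rw [← mul_ne_zero_iff, ← map_mul, mul_star_eq_N, map_intCast, Ne,
    ZMod.intCast_zmod_eq_zero_iff_dvd]
  intro h
  have := hb.isUnit_of_dvd' h dvd_rfl
  rw [Int.ofNat_isUnit, Nat.isUnit_iff] at this
  exact hp.out.ne_one this

variable {r d e : ZMod p}

theorem mul_eq_or_eq_neg_of_dvd (hr : r ^ 2 + r + 1 = 0) (hd : d ^ 2 = 93) {s y : ℤ}
    (hs : (p : ℤ) ∣ s ^ 2 + 31 * y ^ 2) :
    s * (1 + 2 * r) = d * y ∨ s * (1 + 2 * r) = -(d * y) := by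
  rw [← ZMod.intCast_zmod_eq_zero_iff_dvd] at hs
  push_cast at hs
  apply sq_eq_sq_iff_eq_or_eq_neg.1
  linear_combination (-3) * hs + 4 * (s : ZMod p) ^ 2 * hr - (y : ZMod p) ^ 2 * hd

theorem one_add_two_mul_ne_zero (h3 : (3 : ZMod p) ≠ 0) (hr : r ^ 2 + r + 1 = 0) :
    1 + 2 * r ≠ 0 := fun h ↦
  h3 (by linear_combination (1 + 2 * r) * -h + 4 * hr)

theorem cubicSymbol_eq_one_iff_of_im_eq (hp3 : p % 3 = 1) (hr : r ^ 2 + r + 1 = 0)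
    (hd : d ^ 2 = 93) (he : 2 * e = 29 + 3 * d) {s y : ℤ} (hs : (p : ℤ) ∣ s ^ 2 + 31 * y ^ 2)
    {b : EisensteinInt} (hre : 2 * b.re = s - 3 * y) (him : b.im = -3 * y)
    (hb : IsCoprime (N b) p) : cubicSymbol b p = 1 ↔ e ^ ((p - 1) / 3) = 1 := by
  have h3 := three_ne_zero_zmod hp3
  have h2 := two_ne_zero_zmod hp3
  obtain ⟨φ, hφ⟩ := exists_ringHom hr
  obtain ⟨hb1, hb2⟩ := map_ne_zero_of_isCoprime_N φ hb
  have hre' : 2 * (b.re : ZMod p) = s - 3 * y := by exact_mod_cast congrArg (Int.cast) hre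
  have him' : (b.im : ZMod p) = -3 * y := by exact_mod_cast congrArg (Int.cast) him
  have h1 : 2 * φ b = s - 3 * y * (1 + 2 * r) := by
    rw [hφ, him']; linear_combination hre'
  have h1' : 2 * φ (star b) = s + 3 * y * (1 + 2 * r) := by
    rw [hφ]
    simp only [QuadraticAlgebra.re_star, QuadraticAlgebra.im_star]
    push_cast
    rw [him']; linear_combination hre'
  have hr0 := one_add_two_mul_ne_zero h3 hr
  have h4 : 2 * (2 * (1 + 2 * r)) ≠ 0 := mul_ne_zero h2 (mul_ne_zero h2 hr0)
  rw [cubicSymbol_natCast_eq_one_iff h3 φ hb]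
  rcases mul_eq_or_eq_neg_of_dvd hr hd hs with h | h
  · refine pow_eq_pow_iff_of_eq_mul hb2 (mul_left_cancel₀ h4 ?_) _
    linear_combination 2 * (1 + 2 * r) * h1 - (1 + 2 * r) * (2 * e) * h1' -
      (1 + 2 * r) * (s + 3 * y * (1 + 2 * r)) * he + (2 - (29 + 3 * d)) * h -
      (6 + 3 * (29 + 3 * d)) * y * 4 * hr - 3 * y * hd
  · rw [eq_comm]
    refine pow_eq_pow_iff_of_eq_mul hb1 (mul_left_cancel₀ h4 ?_) _
    linear_combination 2 * (1 + 2 * r) * h1' - (1 + 2 * r) * (2 * e) * h1 -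
      (1 + 2 * r) * (s - 3 * y * (1 + 2 * r)) * he + (2 - (29 + 3 * d)) * h +
      (6 + 3 * (29 + 3 * d)) * y * 4 * hr + 3 * y * hd

theorem cubicSymbol_eq_one_iff_of_im_eq_mul (hp3 : p % 3 = 1) (hr : r ^ 2 + r + 1 = 0)
    (hd : d ^ 2 = 93) (he : 2 * e = 29 + 3 * d) {s y : ℤ} (hs : (p : ℤ) ∣ s ^ 2 + 31 * y ^ 2)
    {b : EisensteinInt} (hre : 2 * b.re = 29 * y + 3 * s) (him : b.im = 3 * s)
    (hb : IsCoprime (N b) p) : cubicSymbol b p = 1 ↔ e ^ ((p - 1) / 3) = 1 := by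
  have h3 := three_ne_zero_zmod hp3
  have h2 := two_ne_zero_zmod hp3
  obtain ⟨φ, hφ⟩ := exists_ringHom hr
  obtain ⟨hb1, hb2⟩ := map_ne_zero_of_isCoprime_N φ hb
  have hre' : 2 * (b.re : ZMod p) = 29 * y + 3 * s := by exact_mod_cast congrArg (Int.cast) hre
  have him' : (b.im : ZMod p) = 3 * s := by exact_mod_cast congrArg (Int.cast) him
  have h1 : 2 * φ b = 29 * y + 3 * (s * (1 + 2 * r)) := by
    rw [hφ, him']; linear_combination hre'
  have h1' : 2 * φ (star b) = 29 * y - 3 * (s * (1 + 2 * r)) := by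
    rw [hφ]
    simp only [QuadraticAlgebra.re_star, QuadraticAlgebra.im_star]
    push_cast
    rw [him']; linear_combination hre'
  have h4 : (2 * 2 * 2 : ZMod p) ≠ 0 := mul_ne_zero (mul_ne_zero h2 h2) h2
  have he0 : e ≠ 0 := by
    rintro rfl
    apply h4
    linear_combination -(2 * (29 - 3 * d)) * he + 18 * hd
  rw [cubicSymbol_natCast_eq_one_iff h3 φ hb, ← pow_two_mul_eq_one_iff he0 (by omega)]
  rcases mul_eq_or_eq_neg_of_dvd hr hd hs with h | h
  · refine pow_eq_pow_iff_of_eq_mul hb2 (mul_left_cancel₀ h4 ?_) _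
    linear_combination 4 * h1 - (2 * e) ^ 2 * h1' -
      (2 * e + 29 + 3 * d) * (29 * y - 3 * (s * (1 + 2 * r))) * he +
      (12 + 3 * (29 + 3 * d) ^ 2) * h + 9 * y * (29 + 3 * d) * hd
  · rw [eq_comm]
    refine pow_eq_pow_iff_of_eq_mul hb1 (mul_left_cancel₀ h4 ?_) _
    linear_combination 4 * h1' - (2 * e) ^ 2 * h1 -
      (2 * e + 29 + 3 * d) * (29 * y + 3 * (s * (1 + 2 * r))) * he -
      (12 + 3 * (29 + 3 * d) ^ 2) * h + 9 * y * (29 + 3 * d) * hd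

/-- The reduction of `(29 + 3 √93) / 2` modulo `p` is a cube if and only if `p` is represented by
the principal form of discriminant `-31`. -/
theorem pow_eq_one_iff_exists_eq_form (hp3 : p % 3 = 1) (hr : r ^ 2 + r + 1 = 0)
    (hd : d ^ 2 = 93) (he : 2 * e = 29 + 3 * d) (hres : IsSquare (-31 : ZMod p)) :
    e ^ ((p - 1) / 3) = 1 ↔ ∃ x y : ℤ, (p : ℤ) = x ^ 2 + x * y + 8 * y ^ 2 := by
  have hp2 : p % 2 = 1 := by
    rcases hp.out.eq_two_or_odd with h | h
    · rw [h] at hp3; simp at hp3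
    · exact h
  constructor
  · intro h
    refine (hp.out.exists_eq_form_of_isSquare_neg_thirtyOne hp2 hres).resolve_right ?_
    rintro ⟨x, y, hxy⟩
    obtain ⟨hc, hne⟩ := cubicSymbol_ne_one hp.out hp3 hxy
    refine hne ((cubicSymbol_eq_one_iff_of_im_eq hp3 hr hd he (s := 4 * x + y) (y := y)
      ⟨8, ?_⟩ ?_ rfl hc).2 h)
    · rw [hxy]; ring
    · ring
  · rintro ⟨x, y, hxy⟩
    have hs : (p : ℤ) ∣ (2 * x + y) ^ 2 + 31 * y ^ 2 := ⟨4, by rw [hxy]; ring⟩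
    by_cases h3 : (3 : ℤ) ∣ x - y
    · obtain ⟨hc, h⟩ := cubicSymbol_eq_one_of_three_dvd_sub hp.out hp3 hxy h3
      exact (cubicSymbol_eq_one_iff_of_im_eq_mul hp3 hr hd he hs (by ring) rfl hc).1 h
    · obtain ⟨hc, h⟩ := cubicSymbol_eq_one_of_not_three_dvd_sub hp.out hp3 hxy h3
      exact (cubicSymbol_eq_one_iff_of_im_eq hp3 hr hd he hs (by ring) rfl hc).1 h

end ZMod

end EisensteinInt

theorem isGalois_and_involutive_of_adjoin_eq_top {K : Type*} [Field K] [NumberField K] {α β : K}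
    {a b : ℚ} (hα : α ^ 2 = algebraMap ℚ K a) (hβ : β ^ 2 = algebraMap ℚ K b)
    (h : adjoin ℚ {α, β} = ⊤) :
    IsGalois ℚ K ∧ ∀ (σ : Gal(K/ℚ)) (z : K), σ (σ z) = z := by
  have hs : ∀ x ∈ ({α, β} : Set K), ∃ c : ℚ, x ^ 2 = algebraMap ℚ K c := by
    rintro x (rfl | rfl)
    exacts [⟨a, hα⟩, ⟨b, hβ⟩]
  constructor
  · have : Normal ℚ K := by
      refine normal_iff.2 fun x ↦ ⟨Algebra.IsIntegral.isIntegral x, ?_⟩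
      refine splits_of_mem_adjoin ℚ K (S := {α, β})
        (fun x hx ↦ ⟨Algebra.IsIntegral.isIntegral x, ?_⟩)
        (h ▸ mem_top)
      obtain ⟨c, hc⟩ := hs x hx
      have h1 : minpoly ℚ x ∣ Polynomial.X ^ 2 - Polynomial.C c :=
        minpoly.dvd ℚ x (by simp [hc])
      have h2 := Polynomial.map_dvd (algebraMap ℚ K) h1
      have h3 : (Polynomial.X ^ 2 - Polynomial.C c).map (algebraMap ℚ K) =
          (Polynomial.X - Polynomial.C x) * (Polynomial.X + Polynomial.C x) := by
        simp only [Polynomial.map_sub, Polynomial.map_pow, Polynomial.map_X, Polynomial.map_C]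
        rw [← hc, map_pow]; ring
      refine Polynomial.Splits.of_dvd ?_ ?_ h2
      · rw [h3]
        exact (Polynomial.Splits.X_sub_C x).mul (Polynomial.Splits.X_add_C x)
      · rw [h3]
        exact mul_ne_zero (Polynomial.X_sub_C_ne_zero x) (Polynomial.X_add_C_ne_zero x)
    exact {}
  · intro σ z
    have hz : z ∈ adjoin ℚ {α, β} := h ▸ mem_top
    induction hz using adjoin_induction with
    | mem x hx =>
      obtain ⟨c, hc⟩ := hs x hx
      have h1 : σ x ^ 2 = x ^ 2 := by rw [← map_pow, hc, σ.commutes]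
      rcases sq_eq_sq_iff_eq_or_eq_neg.1 h1 with h2 | h2
      · rw [h2, h2]
      · rw [h2, map_neg, h2, neg_neg]
    | algebraMap x => rw [σ.commutes, σ.commutes]
    | add x y _ _ hx hy => rw [map_add, map_add, hx, hy]
    | inv x _ hx => rw [map_inv₀, map_inv₀, hx]
    | mul x y _ _ hx hy => rw [map_mul, map_mul, hx, hy]

/-- If all automorphisms of a Galois number field are involutions then so are the Frobenius maps of
its residue fields. -/
theorem pow_sq_eq_self_of_involutive {K : Type*} [Field K] [NumberField K] [IsGalois ℚ K]
    (hσ : ∀ (σ : Gal(K/ℚ)) (z : K), σ (σ z) = z) {p : ℕ} (hp : p.Prime) {P : Ideal (𝓞 K)}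
    [hP : P.IsPrime] (hPp : (p : 𝓞 K) ∈ P) (x : 𝓞 K ⧸ P) : x ^ p ^ 2 = x := by
  have hP0 : P ≠ ⊥ := by
    rintro rfl
    rw [Ideal.mem_bot] at hPp
    exact hp.ne_zero (by exact_mod_cast hPp)
  have : Finite (𝓞 K ⧸ P) := Ideal.finiteQuotientOfFreeOfNeBot P hP0
  have hcard : Nat.card (ℤ ⧸ P.under ℤ) = p := by
    have hmax : (Ideal.span {(p : ℤ)}).IsMaximal :=
      PrincipalIdealRing.isMaximal_of_irreducible (Nat.prime_iff_prime_int.1 hp).irreducible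
    have hle : Ideal.span {(p : ℤ)} ≤ P.under ℤ := by
      rw [Ideal.span_singleton_le_iff_mem, Ideal.mem_comap]
      simpa using hPp
    rw [← hmax.eq_of_le (Ideal.IsPrime.ne_top inferInstance) hle,
      Nat.card_congr (Int.quotientSpanNatEquivZMod p).toEquiv, Nat.card_zmod]
  obtain ⟨σ, h⟩ := IsArithFrobAt.exists_of_isInvariant ℤ Gal(K/ℚ) P
  have h1 : ∀ y, Ideal.Quotient.mk P (σ • y) = Ideal.Quotient.mk P y ^ p := by
    intro y
    have := h y
    rw [hcard, ← Ideal.Quotient.eq, map_pow] at this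
    exact this
  obtain ⟨y, rfl⟩ := Ideal.Quotient.mk_surjective x
  rw [sq, pow_mul, ← h1, ← h1]
  congr 1
  ext
  exact hσ σ y

section ZMod

variable {p : ℕ} [hp : Fact p.Prime]

theorem ZMod.exists_sq_add_self_add_one_eq_zero (hp3 : p % 3 = 1) :
    ∃ r : ZMod p, r ^ 2 + r + 1 = 0 := by
  have hdvd : 3 ∣ Nat.card (ZMod p)ˣ := by
    rw [Nat.card_eq_fintype_card, ZMod.card_units]
    omega
  obtain ⟨u, hu⟩ := exists_prime_orderOf_dvd_card' 3 hdvd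
  refine ⟨u, ?_⟩
  have h1 : (u : ZMod p) ≠ 1 := by
    rw [Ne, Units.val_eq_one]
    rintro rfl
    simp at hu
  have h3 : (u : ZMod p) ^ 3 = 1 := by
    rw [← Units.val_pow_eq_pow_val, ← hu, pow_orderOf_eq_one, Units.val_one]
  apply mul_left_cancel₀ (sub_ne_zero.2 h1)
  linear_combination h3

theorem ZMod.exists_cube_eq (hp3 : p % 3 = 1) {e : ZMod p} (he : e ^ ((p - 1) / 3) = 1) :
    ∃ c, c ^ 3 = e := by
  have hm : (p - 1) / 3 ≠ 0 := by
    have := hp.out.two_le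
    omega
  have he0 : e ≠ 0 := by
    rintro rfl
    rw [zero_pow hm] at he
    exact zero_ne_one he
  obtain ⟨g, hg⟩ := IsCyclic.exists_generator (α := (ZMod p)ˣ)
  obtain ⟨k, hk⟩ := mem_powers_iff_mem_zpowers.2 (hg (Units.mk0 e he0))
  have hk' : g ^ k = Units.mk0 e he0 := hk
  have h1 : g ^ (k * ((p - 1) / 3)) = 1 := by
    rw [pow_mul, hk']
    ext
    simpa using he
  rw [← orderOf_dvd_iff_pow_eq_one, orderOf_eq_card_of_forall_mem_zpowers hg,
    Nat.card_eq_fintype_card, ZMod.card_units,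
    show p - 1 = 3 * ((p - 1) / 3) by omega, Nat.mul_div_cancel_left _ three_pos] at h1
  obtain ⟨l, rfl⟩ := Nat.dvd_of_mul_dvd_mul_right (Nat.pos_of_ne_zero hm) h1
  refine ⟨(g : ZMod p) ^ l, ?_⟩
  rw [← pow_mul, mul_comm, ← Units.val_pow_eq_pow_val, hk', Units.val_mk0]

/-- Cubic residuacity of an element of the prime field does not change in the quadratic
extension. -/
theorem exists_cube_eq_map_iff {F : Type*} [Field F] (hF : ∀ x : F, x ^ p ^ 2 = x)
    (hp3 : p % 3 = 1) (f : ZMod p →+* F) {e : ZMod p} (he : e ≠ 0) :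
    (∃ c, c ^ 3 = f e) ↔ e ^ ((p - 1) / 3) = 1 := by
  constructor
  · rintro ⟨c, hc⟩
    have hm : p - 1 = (p - 1) / 3 * 3 := by omega
    have hp2 : p ^ 2 = 3 * ((p - 1) / 3 * (p + 1)) + 1 := by
      generalize (p - 1) / 3 = m at hm ⊢
      obtain rfl : p = m * 3 + 1 := by omega
      ring
    have hc0 : c ≠ 0 := by
      rintro rfl
      rw [zero_pow three_ne_zero, eq_comm, map_eq_zero] at hc
      exact he hc
    have h1 : c ^ (3 * ((p - 1) / 3 * (p + 1))) = 1 := by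
      apply mul_right_cancel₀ hc0
      rw [← pow_succ, ← hp2, hF, one_mul]
    rw [pow_mul, hc, ← map_pow, ← map_one f] at h1
    have h2 := f.injective h1
    rw [pow_mul, pow_succ, ZMod.pow_card] at h2
    rw [← EisensteinInt.pow_two_mul_eq_one_iff he hm, ← h2]
    ring
  · intro h
    obtain ⟨c, rfl⟩ := ZMod.exists_cube_eq hp3 h
    exact ⟨f c, (map_pow f c 3).symm⟩

end ZMod

theorem exists_cube_eq_mk_iff {K : Type*} [Field K] [NumberField K] {α β η : 𝓞 K}
    (hα : α ^ 2 = -3) (hβ : β ^ 2 = 93) (hη : 2 * η = 29 + 3 * β)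
    (h : adjoin ℚ {(α : K), (β : K)} = ⊤) {p : ℕ} (hp : p.Prime) (hp3 : p % 3 = 1)
    (hres : IsSquare (-31 : ZMod p)) {P : Ideal (𝓞 K)} (hP : P.IsPrime) (hPp : (p : 𝓞 K) ∈ P) :
    (∃ c : 𝓞 K ⧸ P, c ^ 3 = Ideal.Quotient.mk P η) ↔
      ∃ x y : ℤ, (p : ℤ) = x ^ 2 + x * y + 8 * y ^ 2 := by
  have : Fact p.Prime := ⟨hp⟩
  have hα' : (α : K) ^ 2 = algebraMap ℚ K (-3) := by
    rw [← map_pow, hα]; simp [map_ofNat (algebraMap (𝓞 K) K) 3]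
  have hβ' : (β : K) ^ 2 = algebraMap ℚ K 93 := by
    rw [← map_pow, hβ]; simp [map_ofNat (algebraMap (𝓞 K) K) 93]
  obtain ⟨hgal, hinv⟩ := isGalois_and_involutive_of_adjoin_eq_top hα' hβ' h
  have hF := pow_sq_eq_self_of_involutive hinv hp hPp
  have hP0 : P ≠ ⊥ := by
    rintro rfl
    rw [Ideal.mem_bot] at hPp
    exact hp.ne_zero (by exact_mod_cast hPp)
  have := hP.isMaximal hP0
  let _ := Ideal.Quotient.field P
  have : CharP (𝓞 K ⧸ P) p := (CharP.charP_iff_prime_eq_zero hp).2 (by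
    rw [← map_natCast (Ideal.Quotient.mk P), Ideal.Quotient.eq_zero_iff_mem]
    exact hPp)
  let f : ZMod p →+* 𝓞 K ⧸ P := ZMod.castHom dvd_rfl _
  obtain ⟨r, hr⟩ := ZMod.exists_sq_add_self_add_one_eq_zero (p := p) hp3
  obtain ⟨d, hd, hdβ⟩ : ∃ d : ZMod p, d ^ 2 = 93 ∧ f d = Ideal.Quotient.mk P β := by
    obtain ⟨s, hs⟩ := hres
    have hd : ((1 + 2 * r) * s) ^ 2 = 93 := by
      linear_combination 3 * hs + 4 * s ^ 2 * hr
    have h1 : f ((1 + 2 * r) * s) ^ 2 = Ideal.Quotient.mk P β ^ 2 := by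
      rw [← map_pow, hd, ← map_pow, hβ, map_ofNat, map_ofNat]
    rcases sq_eq_sq_iff_eq_or_eq_neg.1 h1 with h2 | h2
    · exact ⟨_, hd, h2⟩
    · exact ⟨-((1 + 2 * r) * s), by rw [neg_sq, hd], by rw [map_neg, h2, neg_neg]⟩
  have h2 := EisensteinInt.two_ne_zero_zmod hp3
  obtain ⟨e, he⟩ : ∃ e : ZMod p, 2 * e = 29 + 3 * d := ⟨_, mul_div_cancel₀ _ h2⟩
  have he0 : e ≠ 0 := by
    rintro rfl
    apply mul_ne_zero h2 h2
    linear_combination -(29 - 3 * d) * he + 9 * hd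
  have hfe : f e = Ideal.Quotient.mk P η := by
    have h2' : f 2 ≠ 0 := (map_ne_zero f).2 h2
    apply mul_left_cancel₀ h2'
    rw [← map_mul, he]
    have := congrArg (Ideal.Quotient.mk P) hη
    simp only [map_mul, map_add, map_ofNat] at this ⊢
    rw [this, hdβ]
  rw [← EisensteinInt.pow_eq_one_iff_exists_eq_form hp3 hr hd he hres, ← hfe]
  exact exists_cube_eq_map_iff hF hp3 f he0

/-- Kronecker's example: for the fundamental unit `η = (29 + 3√93)/2` of `ℚ(√93)`:
for a prime `p ≡ 1 mod 3`, `p ≠ 31`, with `(-31/p) = 1`, and `P` a prime of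
`𝓞_{ℚ(√-3,√93)}` above `p`, the unit `η` is a cube in the residue field `𝓞/P` iff
`p = x² + xy + 8y²`. -/
theorem cubic_character_fundamental_unit_sqrt93
    [NumberField Ksqrt93]
    (η : 𝓞 Ksqrt93)
    (hε : ((η : Ksqrt93) : ℂ) = (29 + 3 * ((Real.sqrt 93 : ℝ) : ℂ)) / 2)
    (p : ℕ) (hp : p.Prime) (hp3 : p % 3 = 1) (hp31 : p ≠ 31)
    (hres : IsSquare ((-31 : ZMod p)))
    (P : Ideal (𝓞 Ksqrt93)) (hP : P.IsPrime) (hPp : ((p : ℕ) : 𝓞 Ksqrt93) ∈ P) :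
    (∃ c : 𝓞 Ksqrt93 ⧸ P, c ^ 3 = Ideal.Quotient.mk P η) ↔
      ∃ x y : ℤ, (p : ℤ) = x ^ 2 + x * y + 8 * y ^ 2 := by
  have h3 : (Complex.I * (Real.sqrt 3 : ℂ)) ^ 2 = -3 := by
    rw [mul_pow, Complex.I_sq, ← Complex.ofReal_pow, Real.sq_sqrt (by norm_num)]
    norm_num
  have h93 : ((Real.sqrt 93 : ℝ) : ℂ) ^ 2 = 93 := by
    rw [← Complex.ofReal_pow, Real.sq_sqrt (by norm_num)]
    norm_num
  let a : Ksqrt93 := ⟨_, subset_adjoin ℚ _ (Set.mem_insert _ _)⟩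
  let b : Ksqrt93 := ⟨_, subset_adjoin ℚ _ (Set.mem_insert_of_mem _ rfl)⟩
  have ha : a ^ 2 = -3 := Subtype.ext h3
  have hb : b ^ 2 = 93 := Subtype.ext h93
  have hai : IsIntegral ℤ a := by
    refine .of_pow two_pos (ha ▸ ?_)
    simpa using isIntegral_algebraMap (R := ℤ) (A := Ksqrt93) (x := -3)
  have hbi : IsIntegral ℤ b := by
    refine .of_pow two_pos (hb ▸ ?_)
    simpa using isIntegral_algebraMap (R := ℤ) (A := Ksqrt93) (x := 93)
  refine exists_cube_eq_mk_iff (α := ⟨a, hai⟩) (β := ⟨b, hbi⟩) (RingOfIntegers.ext ha)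
    (RingOfIntegers.ext hb) (RingOfIntegers.ext (Subtype.ext ?_)) ?_ hp hp3 hres hP hPp
  · change 2 * ((η : Ksqrt93) : ℂ) = 29 + 3 * ((Real.sqrt 93 : ℝ) : ℂ)
    rw [hε]
    ring
  · have h : @adjoin ℚ _ Ksqrt93 _ Ksqrt93.algebra' {a, b} = ⊤ := by
      apply IntermediateField.lift_injective Ksqrt93
      rw [lift_adjoin, lift_top, Set.image_pair]
      rfl
    have hAlg : Ksqrt93.algebra' = (DivisionRing.toRatAlgebra : Algebra ℚ Ksqrt93) :=
      Subsingleton.elim _ _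
    rw [hAlg] at h
    exact h
end

section
/- Let p and q be primes with p ≡ 5 (mod 8) and q ≡ 3 (mod 4), and suppose that p is a quadratic residue modulo q. Then for all integers T, U satisfying T² − pq·U² = 1, the integer T is odd and U is divisible by 4. -/
/-- If `x` and `y` are coprime with `x * y = p * q * u ^ 2` and `p ∣ y`, then `x` is a square
modulo `p` as soon as `-1` and `q` are. -/
theorem isSquare_intCast_of_mul_eq_mul_sq {p q : ℕ} (hp : p.Prime) (hq : q.Prime)
    (hneg : IsSquare (-1 : ZMod p)) (hqp : IsSquare (q : ZMod p)) {x y u : ℤ}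
    (hxy : IsCoprime x y) (hmul : x * y = p * q * u ^ 2) (hpy : (p : ℤ) ∣ y) :
    IsSquare (x : ZMod p) := by
  have hp0 : (p : ℤ) ≠ 0 := mod_cast hp.ne_zero
  have hq0 : (q : ℤ) ≠ 0 := mod_cast hq.ne_zero
  have of_coprime {a b : ℤ} (hab : IsCoprime a b) (h : a * b = u ^ 2) :
      IsSquare (a : ZMod p) := by
    obtain ⟨c, rfl | rfl⟩ := Int.sq_of_isCoprime hab h
    · exact ⟨c, by push_cast; ring⟩
    · have : ((-c ^ 2 : ℤ) : ZMod p) = -1 * ((c : ZMod p) * c) := by push_cast; ring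
      rw [this]
      exact hneg.mul ⟨_, rfl⟩
  obtain ⟨z, rfl⟩ := hpy
  have hxz : IsCoprime x z := hxy.of_mul_right_right
  have hmul' : x * z = q * u ^ 2 := mul_left_cancel₀ hp0 (by linear_combination hmul)
  obtain ⟨w, rfl⟩ | ⟨w, rfl⟩ :=
    (Nat.prime_iff_prime_int.mp hq).dvd_or_dvd (Dvd.intro _ hmul'.symm)
  · rw [Int.cast_mul, Int.cast_natCast]
    exact hqp.mul (of_coprime hxz.of_mul_left_right
      (mul_left_cancel₀ hq0 (by linear_combination hmul')))
  · exact of_coprime hxz.of_mul_right_right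
      (mul_left_cancel₀ hq0 (by linear_combination hmul'))

/-- An odd `T` in a solution of the Pell equation `T ^ 2 - D * U ^ 2 = 1` with `D` odd forces
`4 ∣ U`. -/
theorem four_dvd_of_pell_of_odd {D T U : ℤ} (hD : Odd D) (h : T ^ 2 - D * U ^ 2 = 1)
    (hT : Odd T) : 4 ∣ U := by
  have even_of_even {V : ℤ} (hV : Even (D * V ^ 2)) : Even V := by
    rcases Int.even_mul.mp hV with h' | h'
    · exact absurd hD (Int.not_odd_iff_even.mpr h')
    · exact (Int.even_pow.mp h').1
  obtain ⟨k, rfl⟩ := hT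
  obtain ⟨V, rfl⟩ : Even U := even_of_even ⟨2 * (k * (k + 1)), by linear_combination -h⟩
  have hk : k * (k + 1) = D * V ^ 2 := by linarith
  obtain ⟨W, rfl⟩ : Even V := even_of_even (hk ▸ Int.even_mul_succ_self k)
  exact ⟨W, by ring⟩

/-- If `p ≡ 5 mod 8` and `q ≡ 3 mod 4` are primes with `(p/q) = 1`, then every integer
solution of the Pell equation `T² - pq·U² = 1` has `T` odd and `4 ∣ U`. -/
theorem pell_solution_odd_T_four_dvd_U
    (p q : ℕ) (hp : p.Prime) (hq : q.Prime)
    (hp8 : p % 8 = 5) (hq4 : q % 4 = 3)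
    (hres : IsSquare ((p : ZMod q))) :
    ∀ T U : ℤ, T ^ 2 - (p : ℤ) * (q : ℤ) * U ^ 2 = 1 → Odd T ∧ (4 : ℤ) ∣ U := by
  intro T U h
  have : Fact p.Prime := ⟨hp⟩
  have : Fact q.Prime := ⟨hq⟩
  have hneg : IsSquare (-1 : ZMod p) := ZMod.exists_sq_eq_neg_one_iff.mpr (by omega)
  have hqp : IsSquare (q : ZMod p) :=
    (ZMod.exists_sq_eq_prime_iff_of_mod_four_eq_one (by omega) (by omega)).mpr hres
  have h2 : ¬IsSquare (2 : ZMod p) := by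
    rw [ZMod.exists_sq_eq_two_iff (by omega)]
    omega
  have hpq : Odd ((p : ℤ) * q) := by
    refine Odd.mul ?_ ?_ <;> rw [Int.odd_iff] <;> omega
  have hT : Odd T := by
    by_contra hT
    obtain ⟨k, rfl⟩ := Int.not_odd_iff_even.mp hT
    have hcop : IsCoprime (k + k - 1) (k + k + 1) := ⟨k, 1 - k, by ring⟩
    have hmul : (k + k - 1) * (k + k + 1) = p * q * U ^ 2 := by linear_combination h
    have hdvd : (p : ℤ) ∣ (k + k - 1) * (k + k + 1) := ⟨q * U ^ 2, by rw [hmul]; ring⟩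
    rcases (Nat.prime_iff_prime_int.mp hp).dvd_or_dvd hdvd with hd | hd
    · have hsq := isSquare_intCast_of_mul_eq_mul_sq hp hq hneg hqp hcop.symm
        (by rw [mul_comm, hmul]) hd
      have h0 := (ZMod.intCast_zmod_eq_zero_iff_dvd _ p).mpr hd
      push_cast at h0 hsq
      have h2_eq : (2 : ZMod p) = k + k + 1 := by linear_combination -h0
      exact h2 (h2_eq ▸ hsq)
    · have hsq := isSquare_intCast_of_mul_eq_mul_sq hp hq hneg hqp hcop hmul hd
      have h0 := (ZMod.intCast_zmod_eq_zero_iff_dvd _ p).mpr hd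
      push_cast at h0 hsq
      have h2_eq : (2 : ZMod p) = -1 * (k + k - 1) := by linear_combination h0
      exact h2 (h2_eq ▸ hneg.mul hsq)
  exact ⟨hT, four_dvd_of_pell_of_odd hpq h hT⟩
end

section
/- Let ε = 25 + 4√39, the fundamental unit of ℚ(√39), regarded as an element of the ring of integers of K' = ℚ(i, √39) ⊂ ℂ. Let ℓ be a prime with ℓ ≡ 1 (mod 4) such that 39 is a quadratic residue modulo ℓ, and let 𝔏 be any prime ideal of 𝓞_{K'} lying above ℓ. If there exist integers x, y with ℓ = x² + 39y², then ε^{(ℓ−1)/4} ≡ 1 (mod 𝔏); and if there exist integers x, y with ℓ = 3x² + 13y², then ε^{(ℓ−1)/4} ≡ −1 (mod 𝔏). -/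
open NumberField IntermediateField

/-- The field `K' = ℚ(i, √39) ⊂ ℂ`. -/
noncomputable def QiSqrt39 : IntermediateField ℚ ℂ :=
  ℚ⟮Complex.I, ((Real.sqrt 39 : ℝ) : ℂ)⟯

open scoped NumberTheorySymbols


theorem jacobiSym_eq_jacobiSym_natAbs_of_mod_four {p : ℕ} (hp : p % 4 = 1) {n : ℤ} (hn : Odd n) :
    J(n | p) = J(p | n.natAbs) := by
  have hp' : Odd p := Nat.odd_iff.mpr (by omega)
  have h := jacobiSym.quadratic_reciprocity_one_mod_four' (Int.natAbs_odd.mpr hn) hp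
  rcases Int.natAbs_eq n with h' | h'
  · rw [← h, ← h']
  · conv_lhs => rw [h']
    rw [jacobiSym.neg _ hp', h, ZMod.χ₄_nat_one_mod_four hp, one_mul]

/-- Infinite descent: a common inert prime of `A` and `13Y² - C²` can be divided out. -/
theorem jacobiSym_thirteen_ne_neg_one_of_odd (N : ℕ) (A B Y C : ℤ) (hN : A.natAbs ≤ N)
    (hA0 : A ≠ 0) (hA : Odd A) (h : 3 * A * B = 13 * Y ^ 2 - C ^ 2)
    (hcop : ∀ q : ℕ, q.Prime → Odd q → (q : ℤ) ∣ A → (q : ℤ) ∣ B → (q : ℤ) ∣ Y → (q : ℤ) ∣ C →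
      False) : J(A | 13) ≠ -1 := by
  induction N generalizing A B Y C with
  | zero => exact absurd (Int.natAbs_eq_zero.mp (by omega)) hA0
  | succ N ih =>
    intro hJ
    have hJ' := hJ
    have hr := jacobiSym_eq_jacobiSym_natAbs_of_mod_four (p := 13) rfl hA
    rw [hr] at hJ'
    obtain ⟨q, hq, hqA, hJq⟩ := jacobiSym.eq_neg_one_at_prime_divisor_of_eq_neg_one hJ'
    have := Fact.mk hq
    have hqA' : (q : ℤ) ∣ A := Int.natCast_dvd.mpr hqA
    have hqo : Odd q := (Int.natAbs_odd.mpr hA).of_dvd_nat hqA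
    have hd : (q : ℤ) ∣ C ^ 2 - 13 * Y ^ 2 := by
      rw [show C ^ 2 - 13 * Y ^ 2 = A * (-3 * B) by linarith]
      exact hqA'.mul_right _
    obtain ⟨hC, hY⟩ := jacobiSym.prime_dvd_of_eq_neg_one (a := 13) hJq hd
    have hB : ¬ (q : ℤ) ∣ B := fun hB => hcop q hq hqo hqA' hB hY hC
    have hq3 : ¬ (q : ℤ) ∣ 3 := by
      intro h3
      have : q = 3 := (Nat.prime_dvd_prime_iff_eq hq Nat.prime_three).mp (by exact_mod_cast h3)
      subst this
      revert hJq
      rw [jacobiSym.mod_left]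
      norm_num
    have hqp : Prime (q : ℤ) := Nat.prime_iff_prime_int.mp hq
    obtain ⟨Y', rfl⟩ := hY
    obtain ⟨C', rfl⟩ := hC
    obtain ⟨A', rfl⟩ := hqA'
    have hq0 : (q : ℤ) ≠ 0 := hqp.ne_zero
    have h1 : 3 * A' * B = q * (13 * Y' ^ 2 - C' ^ 2) := by
      apply mul_left_cancel₀ hq0; linear_combination h
    have hqA1 : (q : ℤ) ∣ A' := by
      rcases hqp.dvd_or_dvd (Dvd.intro _ h1.symm) with h2 | h2
      · exact (hqp.dvd_or_dvd h2).resolve_left hq3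
      · exact absurd h2 hB
    obtain ⟨A'', rfl⟩ := hqA1
    have h2 : 3 * A'' * B = 13 * Y' ^ 2 - C' ^ 2 := by
      apply mul_left_cancel₀ hq0; linear_combination h1
    have hA''0 : A'' ≠ 0 := by rintro rfl; simp at hA0
    have ho : Odd A'' := by
      rw [Int.odd_mul, Int.odd_mul] at hA; exact hA.2.2
    refine ih A'' B Y' C' ?_ hA''0 ho h2 ?_ ?_
    · rw [Int.natAbs_mul, Int.natAbs_mul, Int.natAbs_natCast] at hN
      have := Int.natAbs_pos.mpr hA''0
      have := hq.two_le
      nlinarith [Nat.mul_le_mul this (Nat.mul_le_mul this (le_refl A''.natAbs))]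
    · intro p hp hpo h3 h4 h5 h6
      exact hcop p hp hpo ((h3.mul_left _).mul_left _) h4 (h5.mul_left _) (h6.mul_left _)
    · rw [← mul_assoc, jacobiSym.mul_left, ← sq, jacobiSym.pow_left] at hJ
      rcases jacobiSym.trichotomy (q : ℤ) 13 with h3 | h3 | h3 <;> simp_all

theorem jacobiSym_thirteen_ne_neg_one (N : ℕ) (A B Y C : ℤ) (hN : A.natAbs ≤ N)
    (hA0 : A ≠ 0) (hAB : Odd A ∨ Odd B) (h : 3 * A * B = 13 * Y ^ 2 - C ^ 2)
    (hcop : ∀ q : ℕ, q.Prime → Odd q → (q : ℤ) ∣ A → (q : ℤ) ∣ B → (q : ℤ) ∣ Y → (q : ℤ) ∣ C →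
      False) : J(A | 13) ≠ -1 := by
  induction N generalizing A B Y C with
  | zero => exact absurd (Int.natAbs_eq_zero.mp (by omega)) hA0
  | succ N ih =>
    rcases Int.even_or_odd A with hA | hA
    swap
    · exact jacobiSym_thirteen_ne_neg_one_of_odd _ A B Y C le_rfl hA0 hA h hcop
    have hB : Odd B := hAB.resolve_left (Int.not_odd_iff_even.mpr hA)
    obtain ⟨A₁, rfl⟩ := even_iff_two_dvd.mp hA
    have h4 : ∀ n : ℤ, J(2 * (2 * n) | 13) = J(n | 13) := by
      intro n
      rw [← mul_assoc, jacobiSym.mul_left, show J(2 * 2 | 13) = 1 by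
        rw [show (2 * 2 : ℤ) = 4 by norm_num]; exact jacobiSym.at_four (by decide), one_mul]
    rcases Int.even_or_odd Y with hY | hY <;> rcases Int.even_or_odd C with hC | hC
    · obtain ⟨Y', rfl⟩ := even_iff_two_dvd.mp hY
      obtain ⟨C', rfl⟩ := even_iff_two_dvd.mp hC
      have h1 : 3 * A₁ * B = 2 * (13 * Y' ^ 2 - C' ^ 2) := by linarith
      have hA₁ : Even A₁ := by
        have : Even (3 * A₁ * B) := h1 ▸ even_two_mul _
        rw [Int.even_mul, Int.even_mul] at this
        rcases this with (h | h) | h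
        · exact absurd h (by decide)
        · exact h
        · exact absurd hB (Int.not_odd_iff_even.mpr h)
      obtain ⟨A₂, rfl⟩ := even_iff_two_dvd.mp hA₁
      rw [h4]
      have hA₂ : A₂ ≠ 0 := by rintro rfl; simp at hA0
      refine ih A₂ B Y' C' (by omega) hA₂ (Or.inr hB) (by linarith) ?_
      intro p hp hpo h3 h4 h5 h6
      exact hcop p hp hpo ((h3.mul_left _).mul_left _) h4 (h5.mul_left _) (h6.mul_left _)
    · exfalso
      have h1 : Odd (13 * Y ^ 2 - C ^ 2) :=
        ((hY.pow_of_ne_zero two_ne_zero).mul_left _).sub_odd hC.pow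
      rw [← h] at h1
      exact (Int.not_even_iff_odd.mpr h1) (by simp [Int.even_mul])
    · exfalso
      have h1 : Odd (13 * Y ^ 2 - C ^ 2) :=
        (Odd.mul (by decide) hY.pow).sub_even (hC.pow_of_ne_zero two_ne_zero)
      rw [← h] at h1
      exact (Int.not_even_iff_odd.mpr h1) (by simp [Int.even_mul])
    · obtain ⟨y, rfl⟩ := hY
      obtain ⟨c, rfl⟩ := hC
      obtain ⟨u, hu⟩ := Int.even_mul_succ_self y
      obtain ⟨v, hv⟩ := Int.even_mul_succ_self c
      have h1 : 3 * A₁ * B = 2 * (3 + 26 * u - 2 * v) := by linarith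
      have hA₁ : Even A₁ := by
        have : Even (3 * A₁ * B) := h1 ▸ even_two_mul _
        rw [Int.even_mul, Int.even_mul] at this
        rcases this with (h | h) | h
        · exact absurd h (by decide)
        · exact h
        · exact absurd hB (Int.not_odd_iff_even.mpr h)
      obtain ⟨A₂, rfl⟩ := even_iff_two_dvd.mp hA₁
      rw [h4]
      have h2 : 3 * A₂ * B = 3 + 26 * u - 2 * v := by linarith
      have ho : Odd A₂ := by
        have : Odd (3 * A₂ * B) := by rw [h2]; exact ⟨1 + 13 * u - v, by ring⟩
        rw [Int.odd_mul, Int.odd_mul] at this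
        exact this.1.2
      have hA₂ : A₂ ≠ 0 := by rintro rfl; simp at hA0
      refine jacobiSym_thirteen_ne_neg_one_of_odd _ A₂ (4 * B) (2 * y + 1) (2 * c + 1) le_rfl hA₂ ho
        (by linear_combination h) ?_
      intro p hp hpo h3 h4 h5 h6
      refine hcop p hp hpo ((h3.mul_left _).mul_left _) ?_ h5 h6
      have hpp := Nat.prime_iff_prime_int.mp hp
      refine (hpp.dvd_or_dvd h4).resolve_left fun h7 => ?_
      have h8 : p ∣ 2 ^ 2 := by exact_mod_cast h7
      have h9 := (Nat.prime_dvd_prime_iff_eq hp Nat.prime_two).mp (hp.dvd_of_dvd_pow h8)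
      subst h9
      exact absurd hpo (by decide)

theorem jacobiSym_thirteen_eq_of_dvd {k A n s : ℤ} (hn : ¬ (13 : ℤ) ∣ n) (hA0 : ¬ (13 : ℤ) ∣ A)
    (hA : J(A | 13) ≠ -1) (hk : ¬ (13 : ℤ) ∣ k) (h : (13 : ℤ) ∣ k * A * n - s ^ 2) :
    J(n | 13) = J(k | 13) := by
  have hne : ∀ {m : ℤ}, ¬ (13 : ℤ) ∣ m → J(m | 13) ≠ 0 := by
    intro m hm h0
    rw [jacobiSym.eq_zero_iff_not_coprime] at h0
    apply h0
    rw [Int.gcd_comm]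
    exact Int.isCoprime_iff_gcd_eq_one.mp
      ((Nat.prime_iff_prime_int.mp (by norm_num : Nat.Prime 13)).coprime_iff_not_dvd.mpr hm)
  have h1 : J(k * A * n | 13) = J(s ^ 2 | 13) :=
    jacobiSym.mod_left' (Int.emod_eq_emod_iff_emod_sub_eq_zero.mpr
      (Int.emod_eq_zero_of_dvd h))
  rw [jacobiSym.mul_left, jacobiSym.mul_left, jacobiSym.pow_left] at h1
  have := hne hn
  have := hne hA0
  have := hne hk
  rcases jacobiSym.trichotomy n 13 with h3 | h3 | h3 <;>
  rcases jacobiSym.trichotomy A 13 with h4 | h4 | h4 <;>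
  rcases jacobiSym.trichotomy k 13 with h5 | h5 | h5 <;>
  rcases jacobiSym.trichotomy s 13 with h6 | h6 | h6 <;> simp_all

theorem isCoprime_of_prime_eq {ℓ : ℕ} (hℓ : ℓ.Prime) {a c j k : ℤ}
    (h : (ℓ : ℤ) = j * a ^ 2 + k * c ^ 2) : IsCoprime a c := by
  have hp := Nat.prime_iff_prime_int.mp hℓ
  refine isCoprime_of_prime_dvd ?_ ?_
  · rintro ⟨rfl, rfl⟩
    exact hp.ne_zero (by simpa using h)
  · rintro z hz ⟨u, rfl⟩ ⟨v, rfl⟩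
    refine hz.not_isUnit (hp.irreducible.squarefree z ⟨j * u ^ 2 + k * v ^ 2, ?_⟩)
    rw [h]; ring

theorem Int.exists_eq_two_pow_mul_odd' {n : ℤ} (hn : n ≠ 0) :
    ∃ (k : ℕ) (m : ℤ), Odd m ∧ n = 2 ^ k * m := by
  obtain ⟨k, m, hm, h⟩ := Nat.exists_eq_two_pow_mul_odd (Int.natAbs_ne_zero.mpr hn)
  have hm' : Odd (m : ℤ) := by exact_mod_cast hm
  rcases Int.natAbs_eq n with h' | h'
  · exact ⟨k, m, hm', by rw [h', h]; push_cast; ring⟩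
  · exact ⟨k, -m, hm'.neg, by rw [h', h]; push_cast; ring⟩

theorem jacobiSym_eq_of_dvd_sub {a b : ℤ} {m : ℤ} (h : m ∣ a - b) :
    J(a | m.natAbs) = J(b | m.natAbs) :=
  jacobiSym.mod_left' (Int.emod_eq_emod_iff_emod_sub_eq_zero.mpr
    (Int.emod_eq_zero_of_dvd (Int.natAbs_dvd.mpr h)))

theorem odd_of_eq_sq_add_twelve_mul_sq {ℓ : ℕ} (hℓ4 : ℓ % 4 = 1) {a c : ℤ}
    (h : (ℓ : ℤ) = a ^ 2 + 12 * c ^ 2) : Odd a := by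
  by_contra ha
  obtain ⟨b, rfl⟩ := even_iff_two_dvd.mp (Int.not_odd_iff_even.mp ha)
  have : (ℓ : ℤ) = 4 * (b ^ 2 + 3 * c ^ 2) := by rw [h]; ring
  omega

theorem mod_eight_of_eq_sq_add_twelve_mul_sq {ℓ : ℕ} (hℓ4 : ℓ % 4 = 1) {a c : ℤ}
    (h : (ℓ : ℤ) = a ^ 2 + 12 * c ^ 2) : (Even c ∧ ℓ % 8 = 1) ∨ (Odd c ∧ ℓ % 8 = 5) := by
  obtain ⟨b, rfl⟩ := odd_of_eq_sq_add_twelve_mul_sq hℓ4 h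
  obtain ⟨u, hu⟩ := Int.even_mul_succ_self b
  rcases Int.even_or_odd c with hc | hc
  · obtain ⟨d, rfl⟩ := even_iff_two_dvd.mp hc
    have : (ℓ : ℤ) = 1 + 8 * (u + 6 * d ^ 2) := by rw [h]; linarith
    exact Or.inl ⟨hc, by omega⟩
  · refine Or.inr ⟨hc, ?_⟩
    obtain ⟨d, rfl⟩ := hc
    have : (ℓ : ℤ) = 5 + 8 * (1 + u + 6 * (d ^ 2 + d)) := by rw [h]; linarith
    omega

theorem jacobiSym_eq_one_of_eq_sq_add_twelve_mul_sq {ℓ : ℕ} (hℓ : ℓ.Prime) (hℓ4 : ℓ % 4 = 1)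
    {a c : ℤ} (h : (ℓ : ℤ) = a ^ 2 + 12 * c ^ 2) (hc : c ≠ 0) : J(c | ℓ) = 1 := by
  obtain ⟨k, m, hm, rfl⟩ := Int.exists_eq_two_pow_mul_odd' hc
  have hcop : IsCoprime a (2 ^ k * m) := isCoprime_of_prime_eq hℓ (j := 1) (k := 12) (by rw [h]; ring)
  have hJm : J(m | ℓ) = 1 := by
    rw [jacobiSym_eq_jacobiSym_natAbs_of_mod_four hℓ4 hm,
      jacobiSym_eq_of_dvd_sub (b := a ^ 2) ⟨12 * 2 ^ (2 * k) * m, by rw [h]; ring⟩]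
    refine jacobiSym.sq_one' ?_
    have := Int.isCoprime_iff_gcd_eq_one.mp hcop.of_mul_right_right
    simpa [Int.gcd, Int.natAbs_abs] using this
  rw [jacobiSym.mul_left, hJm, mul_one, jacobiSym.pow_left]
  rcases mod_eight_of_eq_sq_add_twelve_mul_sq hℓ4 h with ⟨-, h8⟩ | ⟨ho, -⟩
  · rw [jacobiSym.at_two (Nat.odd_iff.mpr (by omega)), ZMod.χ₈_nat_eq_if_mod_eight]
    simp [h8, show ℓ % 2 ≠ 0 by omega]
  · have : k = 0 := by
      by_contra hk
      rw [Int.odd_mul, Int.odd_pow] at ho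
      rcases ho.1 with h1 | h1
      · exact absurd h1 (by decide)
      · exact hk h1
    simp [this]

theorem jacobiSym_sub_eq_jacobiSym_thirteen {ℓ : ℕ} (hℓ : ℓ.Prime) (hℓ4 : ℓ % 4 = 1)
    {a c : ℤ} (h : (ℓ : ℤ) = a ^ 2 + 12 * c ^ 2) (hac : c - a ≠ 0) :
    J(c - a | ℓ) = J(c - a | 13) := by
  obtain ⟨k, m, hm, hkm⟩ := Int.exists_eq_two_pow_mul_odd' hac
  have hcop : IsCoprime a c := isCoprime_of_prime_eq hℓ (j := 1) (k := 12) (by rw [h]; ring)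
  have hcop' : IsCoprime c m := by
    have : IsCoprime c (c - a) := by
      rw [show c - a = -a + 1 * c by ring]
      exact (hcop.symm.neg_right).add_mul_right_right 1
    rw [hkm] at this
    exact this.of_mul_right_right
  have hJm : J(m | ℓ) = J(m | 13) := by
    rw [jacobiSym_eq_jacobiSym_natAbs_of_mod_four hℓ4 hm,
      jacobiSym_eq_jacobiSym_natAbs_of_mod_four (p := 13) rfl hm,
      jacobiSym_eq_of_dvd_sub (b := 13 * c ^ 2) ⟨-(a + c) * 2 ^ k, by
        rw [h]; linear_combination (-(a + c)) * hkm⟩, jacobiSym.mul_left, jacobiSym.sq_one',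
      mul_one, Nat.cast_ofNat]
    simpa [Int.gcd, Int.natAbs_abs] using Int.isCoprime_iff_gcd_eq_one.mp hcop'
  rw [hkm, jacobiSym.mul_left, jacobiSym.mul_left, hJm, jacobiSym.pow_left, jacobiSym.pow_left]
  congr 1
  rcases mod_eight_of_eq_sq_add_twelve_mul_sq hℓ4 h with ⟨he, -⟩ | ⟨-, h8⟩
  · have ho : Odd (c - a) := he.sub_odd (odd_of_eq_sq_add_twelve_mul_sq hℓ4 h)
    have : k = 0 := by
      by_contra hk
      rw [hkm, Int.odd_mul, Int.odd_pow] at ho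
      rcases ho.1 with h1 | h1
      · exact absurd h1 (by decide)
      · exact hk h1
    simp [this]
  · rw [jacobiSym.at_two (Nat.odd_iff.mpr (by omega)), ZMod.χ₈_nat_eq_if_mod_eight,
      jacobiSym.at_two (by decide)]
    simp [h8, show ℓ % 2 ≠ 0 by omega]

theorem thirteen_not_dvd_sub {ℓ : ℕ} (hℓ : ℓ.Prime) (hℓ13 : ℓ ≠ 13)
    {a c : ℤ} (h : (ℓ : ℤ) = a ^ 2 + 12 * c ^ 2) : ¬ (13 : ℤ) ∣ a - c := by
  rintro ⟨d, hd⟩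
  have : (13 : ℤ) ∣ ℓ := ⟨d * (a + c) + c ^ 2, by rw [h]; linear_combination (a + c) * hd⟩
  exact hℓ13 ((Nat.prime_dvd_prime_iff_eq (by norm_num) hℓ).mp (by exact_mod_cast this)).symm

theorem jacobiSym_sub_eq_one {ℓ : ℕ} (hℓ : ℓ.Prime) (hℓ4 : ℓ % 4 = 1) (hℓ13 : ℓ ≠ 13)
    {a c x y : ℤ} (h : (ℓ : ℤ) = a ^ 2 + 12 * c ^ 2) (hxy : (ℓ : ℤ) = x ^ 2 + 39 * y ^ 2) :
    J(a - c | 13) = 1 := by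
  have ha := odd_of_eq_sq_add_twelve_mul_sq hℓ4 h
  have hcop : IsCoprime a c := isCoprime_of_prime_eq hℓ (j := 1) (k := 12) (by rw [h]; ring)
  have h13 : ∀ n : ℤ, (ℓ : ℤ) ≠ 13 * n := fun n hn =>
    hℓ13 ((Nat.prime_dvd_prime_iff_eq (by norm_num) hℓ).mp
      (by exact_mod_cast Dvd.intro n hn.symm)).symm
  have h3 : ∀ n : ℤ, (ℓ : ℤ) ≠ 3 * n := fun n hn => by
    have := (Nat.prime_dvd_prime_iff_eq Nat.prime_three hℓ).mp
      (by exact_mod_cast Dvd.intro n hn.symm)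
    omega
  have hx : Odd x ∧ Even y := by
    rcases Int.even_or_odd x with ⟨u, rfl⟩ | hx <;> rcases Int.even_or_odd y with hy | ⟨v, rfl⟩
    · obtain ⟨v, rfl⟩ := hy
      ring_nf at hxy; omega
    · ring_nf at hxy; omega
    · exact ⟨hx, hy⟩
    · obtain ⟨u, rfl⟩ := hx
      ring_nf at hxy; omega
  obtain ⟨z, rfl⟩ := even_iff_two_dvd.mp hx.2
  have key : ∀ x : ℤ, Odd x → (ℓ : ℤ) = x ^ 2 + 39 * (2 * z) ^ 2 → ¬ (13 : ℤ) ∣ a - x →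
      J(a - c | 13) = 1 := by
    intro x hx hxy hax
    obtain ⟨A, hA⟩ := even_iff_two_dvd.mp (ha.sub_odd hx)
    obtain ⟨B, hB⟩ := even_iff_two_dvd.mp (ha.add_odd hx)
    obtain rfl : a = A + B := by linarith
    obtain rfl : x = B - A := by linarith
    have hAB : A * B = 3 * (13 * z ^ 2 - c ^ 2) := by linarith
    have hA13 : ¬ (13 : ℤ) ∣ A := fun hd => hax (by rw [hA]; exact hd.mul_left 2)
    have hJ : J(A | 13) ≠ -1 := by
      refine jacobiSym_thirteen_ne_neg_one _ A B (3 * z) (3 * c) le_rfl ?_ ?_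
        (by linear_combination 3 * hAB) ?_
      · rintro rfl; simp at hA13
      · by_contra! hcon
        rw [Int.not_odd_iff_even, Int.not_odd_iff_even] at hcon
        exact (Int.not_even_iff_odd.mpr ha) (hcon.1.add hcon.2)
      · intro q hq _ h1 h2 _ h4
        have hqp := Nat.prime_iff_prime_int.mp hq
        rcases hqp.dvd_or_dvd h4 with h5 | h5
        · have : q = 3 := (Nat.prime_dvd_prime_iff_eq hq Nat.prime_three).mp (by exact_mod_cast h5)
          subst this
          obtain ⟨u, hu⟩ := dvd_add h1 h2
          push_cast at hu
          refine h3 (3 * u ^ 2 + 4 * c ^ 2) ?_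
          rw [h, hu]; ring
        · exact hqp.not_isUnit (hcop.isUnit_of_dvd' (dvd_add h1 h2) h5)
    rw [jacobiSym_thirteen_eq_of_dvd (k := 4) (s := 2 * A - c) (thirteen_not_dvd_sub hℓ hℓ13 h) hA13
      hJ (by norm_num) ⟨c ^ 2 * (-1) + 12 * z ^ 2, ?_⟩]
    · exact jacobiSym.at_four (by decide)
    · linear_combination 4 * hAB
  by_cases hax : (13 : ℤ) ∣ a - x
  · refine key (-x) hx.1.neg (by rw [hxy]; ring) fun hax' => ?_
    obtain ⟨u, hu⟩ := hax
    obtain ⟨v, hv⟩ := hax'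
    obtain ⟨w, hw⟩ : (13 : ℤ) ∣ x := by omega
    refine h13 (13 * w ^ 2 + 12 * z ^ 2) ?_
    rw [hxy, hw]; ring
  · exact key x hx.1 hxy hax

theorem jacobiSym_sub_eq_neg_one {ℓ : ℕ} (hℓ : ℓ.Prime) (hℓ4 : ℓ % 4 = 1) (hℓ13 : ℓ ≠ 13)
    {a c x y : ℤ} (h : (ℓ : ℤ) = a ^ 2 + 12 * c ^ 2) (hxy : (ℓ : ℤ) = 3 * x ^ 2 + 13 * y ^ 2) :
    J(a - c | 13) = -1 := by
  have ha := odd_of_eq_sq_add_twelve_mul_sq hℓ4 h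
  have hcop : IsCoprime a c := isCoprime_of_prime_eq hℓ (j := 1) (k := 12) (by rw [h]; ring)
  have h13 : ∀ n : ℤ, (ℓ : ℤ) ≠ 13 * n := fun n hn =>
    hℓ13 ((Nat.prime_dvd_prime_iff_eq (by norm_num) hℓ).mp
      (by exact_mod_cast Dvd.intro n hn.symm)).symm
  have hx : Even x ∧ Odd y := by
    rcases Int.even_or_odd x with hx | ⟨u, rfl⟩ <;> rcases Int.even_or_odd y with ⟨v, rfl⟩ | hy
    · obtain ⟨u, rfl⟩ := hx
      ring_nf at hxy; omega
    · exact ⟨hx, hy⟩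
    · ring_nf at hxy; omega
    · obtain ⟨v, rfl⟩ := hy
      ring_nf at hxy; omega
  obtain ⟨w, rfl⟩ := even_iff_two_dvd.mp hx.1
  have hodd : Odd ((c - w) * (c + w)) := by
    obtain ⟨b, rfl⟩ := ha
    obtain ⟨d, rfl⟩ := hx.2
    obtain ⟨u, hu⟩ := Int.even_mul_succ_self b
    obtain ⟨v, hv⟩ := Int.even_mul_succ_self d
    have : 12 * ((c - w) * (c + w)) = 12 + 8 * (13 * v - u) := by linarith
    rw [Int.odd_iff]; omega
  have key : ∀ w : ℤ, Odd ((c - w) * (c + w)) → (ℓ : ℤ) = 3 * (2 * w) ^ 2 + 13 * y ^ 2 →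
      ¬ (13 : ℤ) ∣ c - w → J(a - c | 13) = -1 := by
    intro w hodd hxy hcw
    have hE : 12 * ((c - w) * (c + w)) = 13 * y ^ 2 - a ^ 2 := by linarith
    have hoA : Odd (c - w) := (Int.odd_mul.mp hodd).1
    have hJ : J(c - w | 13) ≠ -1 := by
      refine jacobiSym_thirteen_ne_neg_one _ (c - w) (4 * (c + w)) y a le_rfl ?_ (Or.inl hoA)
        (by linear_combination hE) ?_
      · intro h0; simp [h0] at hcw
      · intro q hq hqo h1 h2 _ h4
        have hqp := Nat.prime_iff_prime_int.mp hq
        have hq2 : ¬ (q : ℤ) ∣ 2 := fun hd => by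
          have := (Nat.prime_dvd_prime_iff_eq hq Nat.prime_two).mp (by exact_mod_cast hd)
          subst this
          exact absurd hqo (by decide)
        have h2' : (q : ℤ) ∣ c + w := by
          refine (hqp.dvd_or_dvd h2).resolve_left fun hd => hq2 ?_
          exact hqp.dvd_of_dvd_pow (n := 2) (by norm_num; exact hd)
        have hqc : (q : ℤ) ∣ c := by
          refine (hqp.dvd_or_dvd (a := 2) ?_).resolve_left hq2
          have := dvd_add h1 h2'
          rwa [show c - w + (c + w) = 2 * c by ring] at this
        exact hqp.not_isUnit (hcop.isUnit_of_dvd' h4 hqc)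
    have h2 : J(2 | 13) = -1 := by rw [jacobiSym.at_two (by decide)]; rfl
    rw [jacobiSym_thirteen_eq_of_dvd (k := 2) (s := 5 * (a - c + w)) (thirteen_not_dvd_sub hℓ hℓ13 h) hcw
      hJ (by norm_num) ⟨-2 * (a - c + w) ^ 2 + y ^ 2 - c ^ 2 + w ^ 2, ?_⟩, h2]
    linear_combination hE
  by_cases hcw : (13 : ℤ) ∣ c - w
  · refine key (-w) (by rw [mul_comm]; simpa [sub_eq_add_neg] using hodd) (by rw [hxy]; ring)
      fun hcw' => ?_
    obtain ⟨u, hu⟩ := hcw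
    obtain ⟨v, hv⟩ := hcw'
    obtain ⟨t, rfl⟩ : (13 : ℤ) ∣ w := by omega
    refine h13 (12 * 13 * t ^ 2 + y ^ 2) ?_
    rw [hxy]; ring
  · exact key w hodd hxy hcw

/-- A Thue-type representation lemma for the form `a² + 12c²`. -/
theorem exists_eq_sq_add_twelve_mul_sq {ℓ : ℕ} (hℓ : ℓ.Prime) (hℓ4 : ℓ % 4 = 1)
    {r : ZMod ℓ} (hr : r ^ 2 = -3) : ∃ a c : ℤ, (ℓ : ℤ) = a ^ 2 + 12 * c ^ 2 := by
  have := Fact.mk hℓ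
  obtain ⟨n, hn, hn'⟩ : ∃ n : ℕ, n * n < ℓ ∧ ℓ < (n + 1) * (n + 1) := by
    refine ⟨ℓ.sqrt, lt_of_le_of_ne (Nat.sqrt_le ℓ) fun h => ?_, Nat.lt_succ_sqrt ℓ⟩
    exact hℓ.prime.not_isSquare ⟨_, h.symm⟩
  let f : Fin (n + 1) × Fin (n + 1) → ZMod ℓ := fun u =>
    ((u.1 : ℕ) : ZMod ℓ) - r * ((u.2 : ℕ) : ZMod ℓ)
  obtain ⟨⟨u₁, u₂⟩, ⟨v₁, v₂⟩, hne, heq⟩ :=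
    Fintype.exists_ne_map_eq_of_card_lt f (by simpa [ZMod.card] using hn')
  have hu₁ := u₁.2
  have hu₂ := u₂.2
  have hv₁ := v₁.2
  have hv₂ := v₂.2
  obtain ⟨a, ha⟩ : ∃ a : ℤ, a = (u₁ : ℕ) - (v₁ : ℕ) := ⟨_, rfl⟩
  obtain ⟨b, hb⟩ : ∃ b : ℤ, b = (u₂ : ℕ) - (v₂ : ℕ) := ⟨_, rfl⟩
  have hab : (a : ZMod ℓ) = r * b := by
    simp only [f] at heq
    rw [ha, hb]; push_cast; linear_combination heq
  have hdvd : (ℓ : ℤ) ∣ a ^ 2 + 3 * b ^ 2 := by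
    rw [← ZMod.intCast_zmod_eq_zero_iff_dvd]
    push_cast
    rw [hab]; linear_combination (b : ZMod ℓ) ^ 2 * hr
  have ha2 : a ^ 2 ≤ n * n := by
    rw [← sq]; exact sq_le_sq' (by omega) (by omega)
  have hb2 : b ^ 2 ≤ n * n := by
    rw [← sq]; exact sq_le_sq' (by omega) (by omega)
  have hpos : 0 < a ^ 2 + 3 * b ^ 2 := by
    by_contra! hle
    have h1 : a = 0 := by nlinarith [sq_nonneg a, sq_nonneg b]
    have h2 : b = 0 := by nlinarith [sq_nonneg a, sq_nonneg b]
    apply hne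
    ext <;> simp <;> omega
  obtain ⟨k, hk⟩ := hdvd
  have hnℓ : (n * n : ℤ) < ℓ := by exact_mod_cast hn
  have hk0 : 0 < k := by
    by_contra! hle
    nlinarith [Int.natCast_nonneg ℓ]
  have hk4 : k < 4 := by
    by_contra! hle
    nlinarith [Int.natCast_nonneg ℓ]
  have hrep : ∃ a b : ℤ, (ℓ : ℤ) = a ^ 2 + 3 * b ^ 2 := by
    interval_cases k
    · exact ⟨a, b, by linarith⟩
    · exfalso
      rcases Int.even_or_odd' a with ⟨u, rfl | rfl⟩ <;>
      rcases Int.even_or_odd' b with ⟨v, rfl | rfl⟩ <;> ring_nf at hk <;> omega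
    · obtain ⟨d, rfl⟩ : (3 : ℤ) ∣ a :=
        Int.prime_three.dvd_of_dvd_pow (n := 2) ⟨ℓ - b ^ 2, by linarith⟩
      exact ⟨b, d, by linarith⟩
  obtain ⟨a, b, h⟩ := hrep
  rcases Int.even_or_odd' a with ⟨u, rfl | rfl⟩ <;>
  rcases Int.even_or_odd' b with ⟨v, rfl | rfl⟩
  · ring_nf at h; omega
  · ring_nf at h; omega
  · exact ⟨2 * u + 1, v, by rw [h]; ring⟩
  · ring_nf at h; omega

theorem add_two_mul_pow_half_eq {ℓ : ℕ} (hℓ : ℓ.Prime) (hℓ4 : ℓ % 4 = 1) (hℓ13 : ℓ ≠ 13)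
    {a c : ℤ} (h : (ℓ : ℤ) = a ^ 2 + 12 * c ^ 2) {s t : ZMod ℓ} (hs : s ^ 2 = 13)
    (ht : t ^ 2 = 3) : (s + 2 * t) ^ (ℓ / 2) = (J(a - c | 13) : ℤ) := by
  have := Fact.mk hℓ
  have hc : c ≠ 0 := by
    rintro rfl
    exact (Nat.prime_iff_prime_int.mp hℓ).not_isSquare ⟨a, by rw [h]; ring⟩
  have hac : ¬ (13 : ℤ) ∣ a - c := thirteen_not_dvd_sub hℓ hℓ13 h
  have hca : c - a ≠ 0 := fun h0 => hac ⟨0, by linarith⟩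
  have hJ : J((c - a) * c | ℓ) = J(a - c | 13) := by
    rw [jacobiSym.mul_left, jacobiSym_eq_one_of_eq_sq_add_twelve_mul_sq hℓ hℓ4 h hc, mul_one,
      jacobiSym_sub_eq_jacobiSym_thirteen hℓ hℓ4 h hca, ← neg_sub, jacobiSym.neg _ (by decide),
      ZMod.χ₄_nat_one_mod_four (by norm_num), one_mul]
  have hJ1 : J(a - c | 13) = 1 ∨ J(a - c | 13) = -1 := by
    refine jacobiSym.eq_one_or_neg_one ?_
    rw [Int.gcd_comm]
    exact Int.isCoprime_iff_gcd_eq_one.mp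
      ((Nat.prime_iff_prime_int.mp (by norm_num : Nat.Prime 13)).coprime_iff_not_dvd.mpr hac)
  have hpow : (((c - a) * c : ℤ) : ZMod ℓ) ^ (ℓ / 2) = (J(a - c | 13) : ℤ) := by
    rw [← hJ, ← jacobiSym.legendreSym.to_jacobiSym, legendreSym.eq_pow]
  have hsq : ∀ z : ZMod ℓ, z ≠ 0 → (z ^ 2) ^ (ℓ / 2) = 1 := by
    intro z hz
    rw [← pow_mul, show 2 * (ℓ / 2) = ℓ - 1 by omega]
    exact ZMod.pow_card_sub_one_eq_one hz
  have hzero : (a : ZMod ℓ) ^ 2 + 12 * (c : ZMod ℓ) ^ 2 = 0 := by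
    have := congrArg (Int.cast : ℤ → ZMod ℓ) h
    push_cast at this
    rw [← this]; simp
  have hprod : (s + 2 * t) * (((c - a) * c : ℤ) : ZMod ℓ) * (2 * (1 + s)) ^ 2
      = ((s + 2 * t + 1) * ((1 + s) * c - a)) ^ 2 := by
    have h1 : (s + 2 * t + 1) ^ 2 = 2 * (1 + s) * (s + 2 * t) := by
      linear_combination 4 * ht - hs
    have h2 : ((1 + s) * c - a) ^ 2 = 2 * (1 + s) * ((c - a) * c) := by
      linear_combination hzero + (c : ZMod ℓ) ^ 2 * hs
    rw [mul_pow (s + 2 * t + 1), h1, h2]; push_cast; ring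
  have hsmall : ∀ p : ℕ, p.Prime → p % 4 ≠ 1 → ((p : ℕ) : ZMod ℓ) ≠ 0 := by
    intro p hp hp4 h0
    rw [ZMod.natCast_eq_zero_iff] at h0
    rw [Nat.prime_dvd_prime_iff_eq hℓ hp] at h0
    exact hp4 (h0 ▸ hℓ4)
  have h20 : (2 : ZMod ℓ) ≠ 0 := by exact_mod_cast hsmall 2 Nat.prime_two (by norm_num)
  have h30 : (3 : ZMod ℓ) ≠ 0 := by exact_mod_cast hsmall 3 Nat.prime_three (by norm_num)
  have hs1 : 1 + s ≠ 0 := by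
    intro h0
    have : (2 : ZMod ℓ) * (2 * 3) = 0 := by linear_combination (s - 1) * h0 - hs
    simp [h20, h30] at this
  have hst : s + 2 * t ≠ 0 := by
    intro h0
    have : (1 : ZMod ℓ) = 0 := by linear_combination (s - 2 * t) * h0 - hs + 4 * ht
    exact one_ne_zero this
  have hu0 : (((c - a) * c : ℤ) : ZMod ℓ) ≠ 0 := by
    intro h0
    rw [h0, zero_pow (by have := hℓ.two_le; omega)] at hpow
    rcases hJ1 with h1 | h1 <;> simp [h1] at hpow
  have hR : (s + 2 * t + 1) * ((1 + s) * c - a) ≠ 0 := by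
    intro h0
    rw [h0, zero_pow two_ne_zero] at hprod
    exact mul_ne_zero (mul_ne_zero hst hu0) (pow_ne_zero 2 (mul_ne_zero h20 hs1)) hprod
  have hfin : _ ^ (ℓ / 2) = _ ^ (ℓ / 2) := congrArg (· ^ (ℓ / 2)) hprod
  rw [mul_pow, mul_pow, hsq _ (mul_ne_zero h20 hs1), hsq _ hR, hpow, mul_one] at hfin
  rcases hJ1 with h1 | h1
  · simpa [h1] using hfin
  · rw [h1] at hfin ⊢
    push_cast at hfin ⊢
    linear_combination -hfin

theorem pow_quarter_eq_of_sq {F : Type*} [CommRing F] [IsDomain F] {ℓ : ℕ} [CharP F ℓ]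
    (hℓ4 : ℓ % 4 = 1) {e : F} (he : e ^ 2 - 50 * e + 1 = 0) {s t : ZMod ℓ} (hs : s ^ 2 = 13)
    (ht : t ^ 2 = 3) {j : ℤ} (hj : ∀ t : ZMod ℓ, t ^ 2 = 3 → (s + 2 * t) ^ (ℓ / 2) = (j : ℤ)) :
    e ^ ((ℓ - 1) / 4) = j := by
  have main : ∀ t : ZMod ℓ, t ^ 2 = 3 → e = ZMod.castHom dvd_rfl F ((s + 2 * t) ^ 2) →
      e ^ ((ℓ - 1) / 4) = j := by
    intro t ht h
    rw [h, ← map_pow, ← pow_mul, show 2 * ((ℓ - 1) / 4) = ℓ / 2 by omega, hj t ht, map_intCast]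
  have hs' : (ZMod.castHom dvd_rfl F s) ^ 2 = 13 := by rw [← map_pow, hs, map_ofNat]
  have ht' : (ZMod.castHom dvd_rfl F t) ^ 2 = 3 := by rw [← map_pow, ht, map_ofNat]
  have hfac : (e - ZMod.castHom dvd_rfl F ((s + 2 * t) ^ 2)) *
      (e - ZMod.castHom dvd_rfl F ((s + 2 * -t) ^ 2)) = 0 := by
    simp only [map_pow, map_add, map_mul, map_neg, map_ofNat]
    generalize ZMod.castHom dvd_rfl F s = S at *
    generalize ZMod.castHom dvd_rfl F t = T at *
    linear_combination he + (-2 * e + S ^ 2 + 13 - 8 * T ^ 2) * hs' +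
      (-8 * e - 8 * 13 + 16 * T ^ 2 + 48) * ht'
  rcases mul_eq_zero.mp hfac with h | h
  · exact main t ht (sub_eq_zero.mp h)
  · exact main (-t) (by rw [neg_sq, ht]) (sub_eq_zero.mp h)

theorem exists_sqrt_thirteen_and_three {ℓ : ℕ} (hℓ : ℓ.Prime) (hℓ4 : ℓ % 4 = 1) (hℓ3 : ℓ % 3 = 1)
    (hℓres : IsSquare (39 : ZMod ℓ)) : ∃ s t : ZMod ℓ, s ^ 2 = 13 ∧ t ^ 2 = 3 := by
  have := Fact.mk hℓ
  have h3 : IsSquare ((3 : ℤ) : ZMod ℓ) := by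
    refine ZMod.isSquare_of_jacobiSym_eq_one ?_
    have := jacobiSym.quadratic_reciprocity_one_mod_four' (a := 3) (by decide) hℓ4
    rw [Nat.cast_ofNat] at this
    rw [this, jacobiSym.mod_left, show (ℓ : ℤ) % (3 : ℕ) = 1 by omega, jacobiSym.one_left]
  obtain ⟨t, ht⟩ := h3
  obtain ⟨u, hu⟩ := hℓres
  push_cast at ht
  have h30 : (3 : ZMod ℓ) ≠ 0 := by
    intro h0
    have h1 : ((3 : ℕ) : ZMod ℓ) = 0 := by exact_mod_cast h0
    rw [ZMod.natCast_eq_zero_iff, Nat.prime_dvd_prime_iff_eq hℓ Nat.prime_three] at h1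
    omega
  have ht0 : t ≠ 0 := by rintro rfl; simp [h30] at ht
  refine ⟨u / t, t, ?_, by rw [sq, ← ht]⟩
  rw [div_pow, sq t, ← ht, div_eq_iff h30, sq, ← hu]
  norm_num

theorem pow_quarter_eq_jacobiSym {F : Type*} [CommRing F] [IsDomain F] {ℓ : ℕ} [CharP F ℓ]
    (hℓ : ℓ.Prime) (hℓ4 : ℓ % 4 = 1) (hℓ3 : ℓ % 3 = 1) (hℓ13 : ℓ ≠ 13)
    (hℓres : IsSquare (39 : ZMod ℓ)) {e : F} (he : e ^ 2 - 50 * e + 1 = 0) :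
    ∃ a c : ℤ, (ℓ : ℤ) = a ^ 2 + 12 * c ^ 2 ∧ e ^ ((ℓ - 1) / 4) = (J(a - c | 13) : ℤ) := by
  have := Fact.mk hℓ
  obtain ⟨s, t, hs, ht⟩ := exists_sqrt_thirteen_and_three hℓ hℓ4 hℓ3 hℓres
  obtain ⟨i, hi⟩ := ZMod.exists_sq_eq_neg_one_iff.mpr (by omega : ℓ % 4 ≠ 3)
  obtain ⟨a, c, h⟩ := exists_eq_sq_add_twelve_mul_sq hℓ hℓ4 (r := i * t)
    (by rw [mul_pow, ht, sq, ← hi]; ring)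
  exact ⟨a, c, h, pow_quarter_eq_of_sq hℓ4 he hs ht fun t ht =>
    add_two_mul_pow_half_eq hℓ hℓ4 hℓ13 h hs ht⟩

theorem mod_three_eq_one_of_eq {ℓ : ℕ} (hℓ : ℓ.Prime) (hℓ4 : ℓ % 4 = 1) {x z : ℤ}
    (h : (ℓ : ℤ) = x ^ 2 + 3 * z) : ℓ % 3 = 1 := by
  have hx : ¬ (3 : ℤ) ∣ x := by
    rintro ⟨u, rfl⟩
    have h3 : (3 : ℤ) ∣ ℓ := ⟨3 * u ^ 2 + z, by rw [h]; ring⟩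
    have := (Nat.prime_dvd_prime_iff_eq Nat.prime_three hℓ).mp (by exact_mod_cast h3)
    omega
  obtain ⟨u, hu⟩ | ⟨u, hu⟩ : (3 : ℤ) ∣ x - 1 ∨ (3 : ℤ) ∣ x + 1 := by omega
  · have : (ℓ : ℤ) = 3 * (3 * u ^ 2 + 2 * u + z) + 1 := by
      rw [h, show x = 3 * u + 1 by linarith]; ring
    omega
  · have : (ℓ : ℤ) = 3 * (3 * u ^ 2 - 2 * u + z) + 1 := by
      rw [h, show x = 3 * u - 1 by linarith]; ring
    omega

/-- Quartic residue character of `ε = 25 + 4√39`, the fundamental unit of `ℚ(√39)`: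
for a prime `ℓ ≡ 1 mod 4` with `(39/ℓ) = 1` and a prime `𝔏` of `𝓞_{ℚ(i,√39)}` above `ℓ`,
one has `(ε/𝔏)₄ = +1` if `ℓ = x² + 39y²` and `(ε/𝔏)₄ = -1` if `ℓ = 3x² + 13y²`. -/
theorem quartic_character_unit_sqrt39
    [NumberField QiSqrt39]
    (ε : 𝓞 QiSqrt39)
    (hε : ((ε : QiSqrt39) : ℂ) = 25 + 4 * ((Real.sqrt 39 : ℝ) : ℂ))
    (ℓ : ℕ) (hℓ : ℓ.Prime) (hℓ4 : ℓ % 4 = 1) (hℓres : IsSquare ((39 : ZMod ℓ)))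
    (𝔏 : Ideal (𝓞 QiSqrt39)) (h𝔏 : 𝔏.IsPrime) (h𝔏ℓ : ((ℓ : ℕ) : 𝓞 QiSqrt39) ∈ 𝔏) :
    ((∃ x y : ℤ, (ℓ : ℤ) = x ^ 2 + 39 * y ^ 2) → ε ^ ((ℓ - 1) / 4) - 1 ∈ 𝔏) ∧
    ((∃ x y : ℤ, (ℓ : ℤ) = 3 * x ^ 2 + 13 * y ^ 2) → ε ^ ((ℓ - 1) / 4) + 1 ∈ 𝔏) := by
  have hpoly : ε ^ 2 - 50 * ε + 1 = 0 := by
    apply NumberField.RingOfIntegers.coe_injective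
    apply Subtype.coe_injective
    have h39 : ((Real.sqrt 39 : ℝ) : ℂ) ^ 2 = 39 := by
      rw [← Complex.ofReal_pow, Real.sq_sqrt (by norm_num)]; norm_num
    have h50 : (((50 : 𝓞 QiSqrt39) : QiSqrt39) : ℂ) = 50 := by
      change ((algebraMap (𝓞 QiSqrt39) QiSqrt39 50 : QiSqrt39) : ℂ) = 50
      rw [map_ofNat]; rfl
    simp only [map_add, map_sub, map_mul, map_pow, map_one, map_zero]
    push_cast
    rw [h50, hε]
    linear_combination 16 * h39
  have he : (Ideal.Quotient.mk 𝔏 ε) ^ 2 - 50 * Ideal.Quotient.mk 𝔏 ε + 1 = 0 := by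
    rw [← map_ofNat (Ideal.Quotient.mk 𝔏) 50, ← map_mul, ← map_pow, ← map_sub,
      ← map_one (Ideal.Quotient.mk 𝔏), ← map_add, hpoly, map_zero]
  have : CharP (𝓞 QiSqrt39 ⧸ 𝔏) ℓ := by
    rw [CharP.charP_iff_prime_eq_zero hℓ, ← map_natCast (Ideal.Quotient.mk 𝔏)]
    exact Ideal.Quotient.eq_zero_iff_mem.mpr h𝔏ℓ
  constructor
  · rintro ⟨x, y, hxy⟩
    have hℓ13 : ℓ ≠ 13 := by
      rintro rfl
      push_cast at hxy
      have hy : y = 0 := by nlinarith [sq_nonneg x, sq_nonneg y]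
      have h1 : x < 4 := by nlinarith
      have h2 : -4 < x := by nlinarith
      subst hy
      interval_cases x <;> omega
    obtain ⟨a, c, h, hJ⟩ := pow_quarter_eq_jacobiSym hℓ hℓ4
      (mod_three_eq_one_of_eq hℓ hℓ4 (x := x) (z := 13 * y ^ 2) (by rw [hxy]; ring)) hℓ13 hℓres he
    rw [jacobiSym_sub_eq_one hℓ hℓ4 hℓ13 h hxy] at hJ
    rw [← Ideal.Quotient.eq_zero_iff_mem]
    simp [hJ]
  · rintro ⟨x, y, hxy⟩
    rw [← Ideal.Quotient.eq_zero_iff_mem]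
    by_cases hℓ13 : ℓ = 13
    · subst hℓ13
      have h13 : ((13 : ℕ) : 𝓞 QiSqrt39 ⧸ 𝔏) = 0 := CharP.cast_eq_zero _ _
      push_cast at h13
      have h1 : (Ideal.Quotient.mk 𝔏 ε + 1) ^ 2 = 0 := by
        linear_combination he + 4 * Ideal.Quotient.mk 𝔏 ε * h13
      have h2 : Ideal.Quotient.mk 𝔏 ε = -1 :=
        eq_neg_of_add_eq_zero_left (pow_eq_zero_iff two_ne_zero |>.mp h1)
      simp only [map_add, map_pow, map_one, h2]
      norm_num
    · obtain ⟨a, c, h, hJ⟩ := pow_quarter_eq_jacobiSym hℓ hℓ4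
        (mod_three_eq_one_of_eq hℓ hℓ4 (x := y) (z := x ^ 2 + 4 * y ^ 2) (by rw [hxy]; ring))
        hℓ13 hℓres he
      rw [jacobiSym_sub_eq_neg_one hℓ hℓ4 hℓ13 h hxy] at hJ
      simp [hJ]
end

section
/- Let p be a prime with p ≡ 1 (mod 8) and let q be an odd prime. If there exist integers w, y with 2q = w² + p·y², then there exist integers x, z with q = 2x² + 2xz + ((p+1)/2)·z². -/
/-- For a prime `p ≡ 1 mod 8` and an odd prime `q`: if `2q = w² + p y²` has an integer
solution, then `q = 2x² + 2xz + ((p+1)/2) z²` has an integer solution. -/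
theorem representation_by_order_two_form
    (p q : ℕ) (hp : p.Prime) (hp8 : p % 8 = 1) (hq : q.Prime) (hq_odd : Odd q) :
    (∃ w y : ℤ, 2 * (q : ℤ) = w ^ 2 + (p : ℤ) * y ^ 2) →
    ∃ x z : ℤ, (q : ℤ) = 2 * x ^ 2 + 2 * x * z + (((p : ℤ) + 1) / 2) * z ^ 2 := by
  rintro ⟨w, y, h⟩
  obtain ⟨k, hk⟩ : ∃ k : ℤ, (p : ℤ) = 2 * k + 1 := ⟨p / 2, by omega⟩
  have hhalf : ((p : ℤ) + 1) / 2 = k + 1 := by omega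
  have hpar : Even (w - y) := by
    have hsum : Even (w ^ 2 + (p : ℤ) * y ^ 2) := h ▸ even_two_mul _
    have hp_odd : ¬ Even (p : ℤ) := Int.not_even_iff_odd.2 ⟨k, hk⟩
    simpa [Int.even_add, Int.even_sub, Int.even_mul, Int.even_pow, hp_odd] using hsum
  obtain ⟨x, hx⟩ := hpar
  obtain rfl : w = 2 * x + y := by linarith
  refine ⟨x, y, ?_⟩
  rw [hhalf]
  rw [hk] at h
  linarith
end

section
/- Let p be a prime with p ≡ 1 (mod 8), let k = ℚ(√−p), and let 𝔱 be the ideal of 𝓞_k generated by 2 and 1 + √−p. Let 𝔮 be a prime ideal of 𝓞_k whose absolute norm is an odd prime q. If the ideal 𝔮·𝔱 is a principal ideal of 𝓞_k, then there exist integers w, y with 2q = w² + p·y². -/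
open NumberField IntermediateField

/-- The imaginary quadratic field `k = ℚ(√-p) ⊂ ℂ`. -/
noncomputable def Qsqrtneg (p : ℕ) : IntermediateField ℚ ℂ := ℚ⟮(Complex.I * Real.sqrt p : ℂ)⟯

theorem Rat.exists_intCast_eq_of_sq_eq_intCast {r : ℚ} {m : ℤ} (h : r ^ 2 = m) :
    ∃ n : ℤ, r = n := by
  have hden : r.den ^ 2 = 1 := by rw [← Rat.den_pow, h, Rat.den_intCast]
  exact ⟨r.num, (Rat.den_eq_one_iff r).mp (by simpa using hden) |>.symm⟩

/-- A rational pair with integral trace and norm with respect to `√-p`, `p ≡ 1 mod 4`, is integral. -/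
theorem exists_intCast_eq_of_two_mul_of_sq_add_mul_sq {p : ℕ} (hp : p.Prime) (hp4 : p % 4 = 1)
    {a b : ℚ} {T N : ℤ} (hT : 2 * a = T) (hN : a ^ 2 + p * b ^ 2 = N) :
    ∃ w y : ℤ, a = w ∧ b = y := by
  have hp0 : (p : ℚ) ≠ 0 := by exact_mod_cast hp.ne_zero
  obtain ⟨C, hC⟩ : ∃ C : ℤ, p * (2 * b) = C :=
    Rat.exists_intCast_eq_of_sq_eq_intCast (m := p * (4 * N - T ^ 2)) (by
      push_cast
      rw [← hT, ← hN]
      ring)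
  have hC2 : C ^ 2 = p * (4 * N - T ^ 2) := by
    have : (C : ℚ) ^ 2 = p * (4 * N - T ^ 2) := by
      rw [← hC, ← hT, ← hN]
      ring
    exact_mod_cast this
  obtain ⟨B, rfl⟩ : (p : ℤ) ∣ C :=
    (Nat.prime_iff_prime_int.mp hp).dvd_of_dvd_pow (Dvd.intro _ hC2.symm)
  have hB : 2 * b = B := by
    push_cast at hC
    exact mul_left_cancel₀ hp0 hC
  have hTB : T ^ 2 + p * B ^ 2 = 4 * N := by
    have : (T : ℚ) ^ 2 + p * B ^ 2 = 4 * N := by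
      rw [← hB, ← hT, ← hN]
      ring
    exact_mod_cast this
  obtain ⟨m, hm⟩ : ∃ m : ℤ, (p : ℤ) = 4 * m + 1 := ⟨p / 4, by omega⟩
  rw [hm] at hTB
  have hmod : T ^ 2 + B ^ 2 = 4 * (N - m * B ^ 2) := by linear_combination hTB
  obtain ⟨w, hw | hw⟩ := Int.even_or_odd' T <;> obtain ⟨y, hy | hy⟩ := Int.even_or_odd' B
  · refine ⟨w, y, ?_, ?_⟩
    · rw [hw] at hT
      push_cast at hT
      linarith
    · rw [hy] at hB
      push_cast at hB
      linarith
  all_goals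
    subst hw hy
    ring_nf at hmod
    omega

/-- `ℚ(√-p)` is the quadratic algebra `ℚ[X]/(X² + p)`, compatibly with its embedding in `ℂ`. -/
theorem exists_quadraticAlgebra_algEquiv_Qsqrtneg {p : ℕ} (hp : 0 < p) :
    ∃ e : QuadraticAlgebra ℚ (-p : ℚ) 0 ≃ₐ[ℚ] Qsqrtneg p,
      ∀ z, ((e z : Qsqrtneg p) : ℂ) = z.re + z.im * (Complex.I * Real.sqrt p) := by
  have hsq : (Complex.I * Real.sqrt p : ℂ) * (Complex.I * Real.sqrt p) = -p := by
    have h : ((Real.sqrt p : ℂ)) * Real.sqrt p = p := by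
      exact_mod_cast Real.mul_self_sqrt p.cast_nonneg
    linear_combination Complex.I ^ 2 * h + (p : ℂ) * Complex.I_sq
  let f : QuadraticAlgebra ℚ (-p : ℚ) 0 →ₐ[ℚ] ℂ :=
    QuadraticAlgebra.lift ⟨Complex.I * Real.sqrt p, by simp [hsq, Algebra.smul_def]⟩
  have hf (z) : f z = z.re + z.im * (Complex.I * Real.sqrt p) := by
    simp [f, Algebra.smul_def]
  have hinj : Function.Injective f := by
    rw [injective_iff_map_eq_zero]
    intro z hz
    rw [hf] at hz
    have hre : z.re = 0 := by simpa using congrArg Complex.re hz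
    have him : z.im = 0 := by simpa [hp.ne'] using congrArg Complex.im hz
    exact QuadraticAlgebra.ext hre him
  have hrange : f.range = (Qsqrtneg p).toSubalgebra := by
    have hint : IsIntegral ℚ (Complex.I * Real.sqrt p : ℂ) := by
      refine IsIntegral.of_pow two_pos ?_
      rw [sq, hsq]
      exact IsIntegral.neg (by exact_mod_cast isIntegral_algebraMap (R := ℚ) (x := (p : ℚ)))
    rw [Qsqrtneg, adjoin_simple_toSubalgebra_of_isAlgebraic hint.isAlgebraic]
    refine le_antisymm ?_ (Algebra.adjoin_le ?_)
    · rintro _ ⟨z, rfl⟩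
      change f z ∈ _
      rw [hf]
      refine add_mem ?_ (mul_mem ?_ (Algebra.self_mem_adjoin_singleton _ _)) <;>
        exact Subalgebra.algebraMap_mem _ (_ : ℚ)
    · rintro _ rfl
      exact ⟨⟨0, 1⟩, by simp [hf]⟩
  refine ⟨(AlgEquiv.ofInjective f hinj).trans (Subalgebra.equivOfEq _ _ hrange), fun z ↦ ?_⟩
  rw [← hf]
  rfl

theorem QuadraticAlgebra.algebra_norm_eq_norm {R : Type*} [CommRing R] {a b : R}
    (z : QuadraticAlgebra R a b) : Algebra.norm R z = z.norm :=
  z.det_toLinearMap_eq_norm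

theorem norm_Qsqrtneg_eq {p : ℕ} (hp : 0 < p) [NumberField (Qsqrtneg p)] {x : 𝓞 (Qsqrtneg p)}
    {a b : ℚ} (hx : ((x : Qsqrtneg p) : ℂ) = a + b * (Complex.I * Real.sqrt p)) :
    (Algebra.norm ℤ x : ℚ) = a ^ 2 + p * b ^ 2 := by
  obtain ⟨e, he⟩ := exists_quadraticAlgebra_algEquiv_Qsqrtneg hp
  have hxe : (x : Qsqrtneg p) = e ⟨a, b⟩ := Subtype.ext (by rw [hx, he])
  rw [Algebra.coe_norm_int, hxe, Algebra.norm_eq_of_algEquiv, QuadraticAlgebra.algebra_norm_eq_norm,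
    QuadraticAlgebra.norm_def]
  ring

theorem exists_norm_Qsqrtneg_eq_sq_add_mul_sq {p : ℕ} (hp : p.Prime) (hp4 : p % 4 = 1)
    [NumberField (Qsqrtneg p)] (x : 𝓞 (Qsqrtneg p)) :
    ∃ w y : ℤ, Algebra.norm ℤ x = w ^ 2 + p * y ^ 2 := by
  obtain ⟨e, he⟩ := exists_quadraticAlgebra_algEquiv_Qsqrtneg hp.pos
  obtain ⟨⟨a, b⟩, hz⟩ := e.surjective x
  have hx : ((x : Qsqrtneg p) : ℂ) = a + b * (Complex.I * Real.sqrt p) := by rw [← hz, he]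
  have hN := norm_Qsqrtneg_eq hp.pos hx
  have hN1 : (Algebra.norm ℤ (x + 1) : ℚ) = (a + 1) ^ 2 + p * b ^ 2 := by
    refine norm_Qsqrtneg_eq hp.pos ?_
    push_cast
    rw [hx]
    ring
  obtain ⟨w, y, rfl, rfl⟩ := exists_intCast_eq_of_two_mul_of_sq_add_mul_sq hp hp4
    (T := Algebra.norm ℤ (x + 1) - Algebra.norm ℤ x - 1)
    (by push_cast; linear_combination hN - hN1) hN.symm
  exact ⟨w, y, by exact_mod_cast hN⟩

/-- The ideal `(2, 1 + √-p)` has norm `2`. -/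
theorem absNorm_span_two_one_add_sqrt_neg {p : ℕ} (hp : 0 < p) (hp4 : p % 4 = 1)
    [NumberField (Qsqrtneg p)] {t : 𝓞 (Qsqrtneg p)}
    (ht : ((t : Qsqrtneg p) : ℂ) = 1 + Complex.I * Real.sqrt p) :
    Ideal.absNorm (Ideal.span {(2 : 𝓞 (Qsqrtneg p)), t}) = 2 := by
  set T := Ideal.span {(2 : 𝓞 (Qsqrtneg p)), t} with hT
  have htwo : (((2 : 𝓞 (Qsqrtneg p)) : Qsqrtneg p) : ℂ) = 2 := rfl
  have hnorm_two : Algebra.norm ℤ (2 : 𝓞 (Qsqrtneg p)) = 4 := by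
    have h := norm_Qsqrtneg_eq hp (x := 2) (a := 2) (b := 0) (by simp [htwo])
    norm_num at h
    exact_mod_cast h
  have hnorm_t : Algebra.norm ℤ t = 1 + p := by
    have h := norm_Qsqrtneg_eq hp (x := t) (a := 1) (b := 1) (by simp [ht])
    norm_num at h
    exact_mod_cast h
  have hdvd_four : Ideal.absNorm T ∣ 4 := by
    have h := Ideal.absNorm_dvd_norm_of_mem (I := T) (x := 2) (Ideal.subset_span (by simp))
    rw [hnorm_two] at h
    exact_mod_cast h
  have hdvd_t : Ideal.absNorm T ∣ 1 + p := by
    have h := Ideal.absNorm_dvd_norm_of_mem (I := T) (x := t) (Ideal.subset_span (by simp))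
    rw [hnorm_t] at h
    exact_mod_cast h
  have hsq_le : T * T ≤ Ideal.span {2} := by
    obtain ⟨m, hm⟩ : ∃ m : ℕ, 1 + p = 2 * m := ⟨(1 + p) / 2, by omega⟩
    have htt : t * t = 2 * (t - m) := by
      have h : ((Real.sqrt p : ℂ)) * Real.sqrt p = p := by
        exact_mod_cast Real.mul_self_sqrt p.cast_nonneg
      have hm' : (1 + p : ℂ) = 2 * m := by exact_mod_cast hm
      apply RingOfIntegers.ext
      apply Subtype.ext
      simp only [map_mul, map_sub, map_natCast, MulMemClass.coe_mul, AddSubgroupClass.coe_sub,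
        SubringClass.coe_natCast, ht, htwo]
      linear_combination Complex.I ^ 2 * h + (p : ℂ) * Complex.I_sq - hm'
    rw [hT, Ideal.span_pair_mul_span_pair, Ideal.span_le]
    rintro x (rfl | rfl | rfl | rfl) <;> rw [SetLike.mem_coe, Ideal.mem_span_singleton]
    exacts [dvd_mul_right _ _, dvd_mul_right _ _, dvd_mul_left _ _, htt ▸ dvd_mul_right _ _]
  have hfour_dvd : 4 ∣ Ideal.absNorm T * Ideal.absNorm T := by
    have h := Ideal.absNorm_dvd_absNorm_of_le hsq_le
    rwa [map_mul, Ideal.absNorm_span_singleton, hnorm_two] at h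
  have hle : Ideal.absNorm T ≤ 4 := Nat.le_of_dvd four_pos hdvd_four
  interval_cases Ideal.absNorm T <;> omega

/-- For `p ≡ 1 mod 8` prime, `k = ℚ(√-p)`, `𝔱 = (2, 1 + √-p)` and a prime ideal `𝔮` of
`𝓞 k` of odd prime norm `q`: if `𝔮𝔱` is principal, then `2q = w² + p y²` for some
integers `w, y`. -/
theorem norm_form_representation_of_principal_product
    (p : ℕ) (hp : p.Prime) (hp8 : p % 8 = 1)
    [NumberField (Qsqrtneg p)]
    (t : 𝓞 (Qsqrtneg p))
    (ht : ((t : Qsqrtneg p) : ℂ) = 1 + Complex.I * Real.sqrt p)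
    (𝔱 : Ideal (𝓞 (Qsqrtneg p))) (h𝔱 : 𝔱 = Ideal.span {(2 : 𝓞 (Qsqrtneg p)), t})
    (q : ℕ) (hq : q.Prime) (hq_odd : Odd q)
    (𝔮 : Ideal (𝓞 (Qsqrtneg p))) (h𝔮 : 𝔮.IsPrime) (h𝔮norm : Ideal.absNorm 𝔮 = q)
    (hprinc : (𝔮 * 𝔱).IsPrincipal) :
    ∃ w y : ℤ, 2 * (q : ℤ) = w ^ 2 + (p : ℤ) * y ^ 2 := by
  have hp4 : p % 4 = 1 := by omega
  obtain ⟨x, hx⟩ := hprinc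
  obtain ⟨w, y, hxwy⟩ := exists_norm_Qsqrtneg_eq_sq_add_mul_sq hp hp4 x
  have hnorm : q * 2 = (Algebra.norm ℤ x).natAbs := by
    rw [← Ideal.absNorm_span_singleton, Ideal.span, ← hx, map_mul, h𝔮norm, h𝔱,
      absNorm_span_two_one_add_sqrt_neg hp.pos hp4 ht]
  have hnonneg : 0 ≤ w ^ 2 + (p : ℤ) * y ^ 2 := by positivity
  exact ⟨w, y, by omega⟩
end
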